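/- arXiv:2001.08046 — 11 statements merged into one kernel-verified Lean document; each statement's English description precedes it below -/
import Mathlib

section
/- Let n ≥ 1 and let A be an n×n complex Hermitian matrix with eigenvalues α_1, …, α_n (listed with multiplicity). Then the vector of diagonal entries (Re(A_{11}), …, Re(A_{nn})) ∈ ℝⁿ lies in the permutahedron P_α, i.e., in the convex hull of the set of vectors (α_{σ(1)}, …, α_{σ(n)}) over all permutations σ of {1, …, n}. -/
open Matrix in
/-- The entrywise squared modulus of a unitary matrix is doubly stochastic. -/
theorem Matrix.normSq_mem_doublyStochastic {n : Type*} [Fintype n] [DecidableEq n]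
    {U : Matrix n n ℂ} (hU : U ∈ unitaryGroup n ℂ) :
    U.map Complex.normSq ∈ doublyStochastic ℝ n := by
  refine mem_doublyStochastic_iff_sum.2
    ⟨fun i j => Complex.normSq_nonneg _, fun i => ?_, fun j => ?_⟩
  · have h := congr_fun₂ (mem_unitaryGroup_iff.1 hU) i i
    simp only [mul_apply, star_apply, one_apply_eq, RCLike.star_def, Complex.mul_conj] at h
    exact_mod_cast h
  · have h := congr_fun₂ (mem_unitaryGroup_iff'.1 hU) j j
    simp only [mul_apply, star_apply, one_apply_eq, RCLike.star_def,
      ← Complex.normSq_eq_conj_mul_self] at h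
    exact_mod_cast h

open Matrix in
/-- The image of a vector under a doubly stochastic matrix lies in the convex hull of the
permutations of that vector. -/
theorem Matrix.mulVec_mem_convexHull_of_mem_doublyStochastic {n : Type*} [Fintype n]
    [DecidableEq n] {M : Matrix n n ℝ} (hM : M ∈ doublyStochastic ℝ n) (x : n → ℝ) :
    M *ᵥ x ∈ convexHull ℝ {v : n → ℝ | ∃ σ : Equiv.Perm n, v = x ∘ σ} := by
  rw [← SetLike.mem_coe, doublyStochastic_eq_convexHull_permMatrix] at hM
  have h := Set.mem_image_of_mem ((mulVecBilin ℝ ℝ).flip x) hM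
  rw [LinearMap.image_convexHull] at h
  refine convexHull_mono ?_ h
  rintro _ ⟨_, ⟨σ, rfl⟩, rfl⟩
  exact ⟨σ, permMatrix_mulVec σ⟩

open Matrix in
/-- The diagonal of a Hermitian matrix is the image of its eigenvalues under the entrywise squared
modulus of the unitary matrix of eigenvectors. -/
theorem Matrix.IsHermitian.re_diag_eq_mulVec_eigenvalues {n : Type*} [Fintype n] [DecidableEq n]
    {A : Matrix n n ℂ} (hA : A.IsHermitian) :
    (fun i => (A i i).re) =
      (hA.eigenvectorUnitary : Matrix n n ℂ).map Complex.normSq *ᵥ hA.eigenvalues := by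
  ext i
  have h : A i i = ∑ j, ((Complex.normSq ((hA.eigenvectorUnitary : Matrix n n ℂ) i j) *
      hA.eigenvalues j : ℝ) : ℂ) := by
    conv_lhs => rw [hA.spectral_theorem, Unitary.conjStarAlgAut_apply, mul_apply]
    refine Finset.sum_congr rfl fun j _ => ?_
    rw [mul_diagonal, star_apply, Complex.ofReal_mul, ← Complex.mul_conj]
    simp only [Function.comp_apply, RCLike.star_def, Complex.coe_algebraMap]
    ring
  rw [h, ← Complex.ofReal_sum, Complex.ofReal_re]
  rfl

/-- Schur's theorem (Horn): the vector of diagonal entries of an `n × n` Hermitian matrix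
lies in the permutahedron of its eigenvalue vector, i.e., in the convex hull of all
permutations of the vector of eigenvalues (listed with multiplicity). -/
theorem diag_mem_permutahedron_of_isHermitian
    (n : ℕ) (hn : 1 ≤ n) (A : Matrix (Fin n) (Fin n) ℂ) (hA : A.IsHermitian) :
    (fun i => (A i i).re) ∈
      convexHull ℝ {v : Fin n → ℝ | ∃ σ : Equiv.Perm (Fin n), v = hA.eigenvalues ∘ σ} := by
  rw [hA.re_diag_eq_mulVec_eigenvalues]
  exact Matrix.mulVec_mem_convexHull_of_mem_doublyStochastic
    (Matrix.normSq_mem_doublyStochastic hA.eigenvectorUnitary.2) _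
end

section
/- Let α > 0 be a real number and let D = diag(α, −α) be the 2×2 real diagonal matrix with entries α and −α. Consider the map f from the special unitary group SU(2) to ℝ given by f(U) = Re((U · D · Uᴴ)_{11}), the (1,1) diagonal entry of the conjugated matrix. Then the pushforward of the Haar probability measure on SU(2) under f is the uniform probability measure on the interval [−α, α], i.e., (2α)⁻¹ times Lebesgue measure restricted to [−α, α]. -/
open MeasureTheory Matrix

/-- We endow the space of `2 × 2` complex matrices with its Borel σ-algebra. -/
noncomputable instance : MeasurableSpace (Matrix (Fin 2) (Fin 2) ℂ) := borel _

instance : BorelSpace (Matrix (Fin 2) (Fin 2) ℂ) := ⟨rfl⟩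

open Polynomial

/-- Polynomial moments determine a probability measure carried by a compact interval. -/
theorem MeasureTheory.Measure.ext_of_moments_of_Icc {P Q : Measure ℝ} [IsProbabilityMeasure P]
    [IsProbabilityMeasure Q] {a b : ℝ} (hP : ∀ᵐ x ∂P, x ∈ Set.Icc a b)
    (hQ : ∀ᵐ x ∂Q, x ∈ Set.Icc a b) (h : ∀ n : ℕ, ∫ x, x ^ n ∂P = ∫ x, x ^ n ∂Q) : P = Q := by
  have integrable_of_continuous : ∀ (ν : Measure ℝ) [IsProbabilityMeasure ν],
      (∀ᵐ x ∂ν, x ∈ Set.Icc a b) → ∀ g : ℝ → ℝ, Continuous g → Integrable g ν := by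
    intro ν _ hν g hg
    obtain ⟨C, hC⟩ := isCompact_Icc.exists_bound_of_continuousOn (s := Set.Icc a b) hg.continuousOn
    exact Integrable.of_bound hg.aestronglyMeasurable C (hν.mono fun x hx => hC x hx)
  have integral_eval : ∀ p : ℝ[X], ∫ x, p.eval x ∂P = ∫ x, p.eval x ∂Q := by
    intro p
    induction p using Polynomial.induction_on' with
    | add p q hp hq =>
      simp only [eval_add]
      rw [integral_add (integrable_of_continuous P hP _ p.continuous)
          (integrable_of_continuous P hP _ q.continuous),
        integral_add (integrable_of_continuous Q hQ _ p.continuous)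
          (integrable_of_continuous Q hQ _ q.continuous), hp, hq]
    | monomial n c => simp only [eval_monomial, integral_const_mul, h]
  refine ext_of_forall_integral_eq_of_IsFiniteMeasure fun g => ?_
  refine eq_of_forall_dist_le fun ε hε => ?_
  obtain ⟨p, hp⟩ := exists_polynomial_near_of_continuousOn a b g g.continuous.continuousOn
    (ε / 2) (half_pos hε)
  have near : ∀ (ν : Measure ℝ) [IsProbabilityMeasure ν],
      (∀ᵐ x ∂ν, x ∈ Set.Icc a b) → dist (∫ x, p.eval x ∂ν) (∫ x, g x ∂ν) ≤ ε / 2 := by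
    intro ν _ hν
    rw [dist_eq_norm, ← integral_sub (integrable_of_continuous ν hν _ p.continuous)
      (integrable_of_continuous ν hν _ g.continuous)]
    simpa using norm_integral_le_of_norm_le_const (μ := ν) (C := ε / 2)
      (f := fun x => p.eval x - g x) (hν.mono fun x hx => (hp x hx).le)
  have hdist := dist_triangle_left (∫ x, g x ∂P) (∫ x, g x ∂Q) (∫ x, p.eval x ∂P)
  have hnear := near Q hQ
  rw [← integral_eval] at hnear
  linarith [near P hP]

section Moments

variable {Ω : Type*} [MeasurableSpace Ω] {μ : Measure Ω} [IsProbabilityMeasure μ]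

theorem integrable_pow_mul_pow_of_abs_le_one {X Y : Ω → ℝ} (hX : Measurable X) (hY : Measurable Y)
    (hX1 : ∀ᵐ ω ∂μ, |X ω| ≤ 1) (hY1 : ∀ᵐ ω ∂μ, |Y ω| ≤ 1) (i j : ℕ) :
    Integrable (fun ω => X ω ^ i * Y ω ^ j) μ := by
  refine Integrable.of_bound (by fun_prop) 1 ?_
  filter_upwards [hX1, hY1] with ω h h'
  rw [norm_mul, norm_pow, norm_pow]
  exact mul_le_one₀ (pow_le_one₀ (norm_nonneg _) h) (by positivity)
    (pow_le_one₀ (norm_nonneg _) h')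

/-- If the even moments of `X` agree with those of all rotations `cos θ X + sin θ Y`, comparing
second-order terms in `tan θ` expresses mixed moments of `X` and `Y` through moments of `X`. -/
theorem integral_pow_mul_sq_of_rotation {X Y : Ω → ℝ} (hX : Measurable X) (hY : Measurable Y)
    (hX1 : ∀ᵐ ω ∂μ, |X ω| ≤ 1) (hY1 : ∀ᵐ ω ∂μ, |Y ω| ≤ 1)
    (h : ∀ (n : ℕ) (θ : ℝ),
      ∫ ω, (Real.cos θ * X ω + Real.sin θ * Y ω) ^ n ∂μ = ∫ ω, X ω ^ n ∂μ) (m : ℕ) :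
    (2 * m + 1) * ∫ ω, X ω ^ (2 * m) * Y ω ^ 2 ∂μ = ∫ ω, X ω ^ (2 * m + 2) ∂μ := by
  set n := 2 * m + 2 with hn
  let p : ℝ[X] := ∑ k ∈ Finset.range (n + 1),
    monomial k ((n.choose k : ℝ) * ∫ ω, X ω ^ (n - k) * Y ω ^ k ∂μ)
  let q : ℝ[X] := C (∫ ω, X ω ^ n ∂μ) * expand ℝ 2 ((1 + Polynomial.X) ^ (m + 1))
  have hpq : p = q := by
    refine Polynomial.funext fun t => ?_
    have hp : p.eval t = ∫ ω, (X ω + t * Y ω) ^ n ∂μ := by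
      have expansion : ∀ ω, (X ω + t * Y ω) ^ n = ∑ k ∈ Finset.range (n + 1),
          (n.choose k * t ^ k) * (X ω ^ (n - k) * Y ω ^ k) := by
        intro ω
        rw [add_comm, add_pow]
        exact Finset.sum_congr rfl fun k _ => by ring
      simp only [expansion]
      rw [integral_finsetSum _ fun k _ =>
        (integrable_pow_mul_pow_of_abs_le_one hX hY hX1 hY1 _ _).const_mul _]
      simp only [p, eval_finsetSum, eval_monomial, integral_const_mul]
      exact Finset.sum_congr rfl fun k _ => by ring
    have hq : q.eval t = (1 + t ^ 2) ^ (m + 1) * ∫ ω, X ω ^ n ∂μ := by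
      simp [q, mul_comm]
    have hr : 0 < 1 + t ^ 2 := by positivity
    have scaling : ∀ ω, (X ω + t * Y ω) ^ n = (1 + t ^ 2) ^ (m + 1) *
        (Real.cos (Real.arctan t) * X ω + Real.sin (Real.arctan t) * Y ω) ^ n := by
      intro ω
      have hs : Real.sqrt (1 + t ^ 2) ≠ 0 := (Real.sqrt_pos.2 hr).ne'
      have hpow : (1 + t ^ 2) ^ (m + 1) = Real.sqrt (1 + t ^ 2) ^ n := by
        rw [hn, show 2 * m + 2 = 2 * (m + 1) by ring, pow_mul, Real.sq_sqrt hr.le]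
      rw [hpow, ← mul_pow, Real.cos_arctan, Real.sin_arctan]
      congr 1
      field_simp
    rw [hp, hq]
    simp only [scaling]
    rw [integral_const_mul, h]
  have hcoeff := congrArg (fun r => coeff r 2) hpq
  have hp2 : p.coeff 2 = (n.choose 2 : ℝ) * ∫ ω, X ω ^ (2 * m) * Y ω ^ 2 ∂μ := by
    simp only [p, finsetSum_coeff, coeff_monomial]
    rw [Finset.sum_ite_eq', if_pos (by simp [hn])]
    simp [hn]
  have hq2 : q.coeff 2 = (m + 1) * ∫ ω, X ω ^ n ∂μ := by
    simp only [q, coeff_C_mul, coeff_expand two_pos]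
    simp [coeff_one_add_X_pow, mul_comm]
  have hchoose : (n.choose 2 : ℝ) = (m + 1) * (2 * m + 1) := by
    rw [Nat.cast_choose_two, hn]
    push_cast
    ring
  simp only [hp2, hq2, hchoose, mul_assoc] at hcoeff
  exact mul_left_cancel₀ (by positivity) hcoeff

/-- The moments of a coordinate of a rotation-invariant random point of the sphere are those of
the uniform distribution on `[-1, 1]`. -/
theorem integral_pow_of_rotation {X Y Z : Ω → ℝ} (hX : Measurable X) (hY : Measurable Y)
    (hZ : Measurable Z) (hsphere : ∀ᵐ ω ∂μ, X ω ^ 2 + Y ω ^ 2 + Z ω ^ 2 = 1)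
    (hXY : ∀ (n : ℕ) (θ : ℝ),
      ∫ ω, (Real.cos θ * X ω + Real.sin θ * Y ω) ^ n ∂μ = ∫ ω, X ω ^ n ∂μ)
    (hXZ : ∀ (n : ℕ) (θ : ℝ),
      ∫ ω, (Real.cos θ * X ω + Real.sin θ * Z ω) ^ n ∂μ = ∫ ω, X ω ^ n ∂μ) (n : ℕ) :
    ∫ ω, X ω ^ n ∂μ = (1 - (-1) ^ (n + 1)) / (2 * (n + 1)) := by
  have hX1 : ∀ᵐ ω ∂μ, |X ω| ≤ 1 := hsphere.mono fun ω h => abs_le_one_iff_mul_self_le_one.2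
    (by nlinarith [sq_nonneg (Y ω), sq_nonneg (Z ω)])
  have hY1 : ∀ᵐ ω ∂μ, |Y ω| ≤ 1 := hsphere.mono fun ω h => abs_le_one_iff_mul_self_le_one.2
    (by nlinarith [sq_nonneg (X ω), sq_nonneg (Z ω)])
  have hZ1 : ∀ᵐ ω ∂μ, |Z ω| ≤ 1 := hsphere.mono fun ω h => abs_le_one_iff_mul_self_le_one.2
    (by nlinarith [sq_nonneg (X ω), sq_nonneg (Y ω)])
  obtain ⟨m, rfl | rfl⟩ := n.even_or_odd'
  · suffices hm : ∫ ω, X ω ^ (2 * m) ∂μ = 1 / (2 * m + 1) by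
      rw [hm, pow_succ, pow_mul]
      push_cast
      field_simp
      norm_num
    induction m with
    | zero => simp
    | succ m ih =>
      have hmY := integral_pow_mul_sq_of_rotation hX hY hX1 hY1 hXY m
      have hmZ := integral_pow_mul_sq_of_rotation hX hZ hX1 hZ1 hXZ m
      have hsum : ∫ ω, X ω ^ (2 * m) * Y ω ^ 2 ∂μ + ∫ ω, X ω ^ (2 * m) * Z ω ^ 2 ∂μ
          + ∫ ω, X ω ^ (2 * m + 2) ∂μ = ∫ ω, X ω ^ (2 * m) ∂μ := by
        have hiY := integrable_pow_mul_pow_of_abs_le_one hX hY hX1 hY1 (2 * m) 2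
        have hiZ := integrable_pow_mul_pow_of_abs_le_one hX hZ hX1 hZ1 (2 * m) 2
        have hiX := integrable_pow_mul_pow_of_abs_le_one hX hX hX1 hX1 (2 * m) 2
        simp only [pow_add (X _) (2 * m) 2]
        rw [← integral_add hiY hiZ, ← integral_add (hiY.fun_add hiZ) hiX]
        refine integral_congr_ae (hsphere.mono fun ω hω => ?_)
        linear_combination X ω ^ (2 * m) * hω
      rw [ih] at hsum
      rw [show 2 * (m + 1) = 2 * m + 2 by ring]
      push_cast
      field_simp at hsum ⊢
      linear_combination hsum - hmY - hmZ
  · have hneg := hXY (2 * m + 1) Real.pi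
    simp only [Real.cos_pi, Real.sin_pi, zero_mul, add_zero, neg_one_mul,
      (odd_two_mul_add_one m).neg_pow, integral_neg] at hneg
    have hzero : ∫ ω, X ω ^ (2 * m + 1) ∂μ = 0 := by linarith
    rw [hzero, (show Even (2 * m + 1 + 1) from ⟨m + 1, by ring⟩).neg_one_pow, sub_self, zero_div]

end Moments

/-- The uniform distribution on `[-α, α]` is a probability measure. -/
theorem isProbabilityMeasure_uniform_Icc {α : ℝ} (hα : 0 < α) :
    IsProbabilityMeasure
      ((ENNReal.ofReal (2 * α))⁻¹ • (volume.restrict (Set.Icc (-α) α) : Measure ℝ)) := by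
  constructor
  rw [Measure.smul_apply, Measure.restrict_apply_univ, Real.volume_Icc, smul_eq_mul,
    show α - -α = 2 * α by ring]
  exact ENNReal.inv_mul_cancel (by simpa using hα) ENNReal.ofReal_ne_top

theorem integral_pow_uniform_Icc {α : ℝ} (hα : 0 < α) (n : ℕ) :
    ∫ x, x ^ n ∂((ENNReal.ofReal (2 * α))⁻¹ • (volume.restrict (Set.Icc (-α) α) : Measure ℝ))
      = α ^ n * ((1 - (-1) ^ (n + 1)) / (2 * (n + 1))) := by
  rw [integral_smul_measure, integral_Icc_eq_integral_Ioc,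
    ← intervalIntegral.integral_of_le (by linarith), integral_pow, ENNReal.toReal_inv,
    ENNReal.toReal_ofReal (by positivity), smul_eq_mul, neg_pow]
  field_simp
  ring

theorem mem_specialUnitaryGroup_of_normSq_add_normSq {a b : ℂ}
    (h : Complex.normSq a + Complex.normSq b = 1) :
    !![a, b; -star b, star a] ∈ specialUnitaryGroup (Fin 2) ℂ := by
  have h' : a * star a + b * star b = 1 := by
    simpa [Complex.mul_conj] using congrArg Complex.ofReal h
  rw [mem_specialUnitaryGroup_iff, mem_unitaryGroup_iff]
  constructor
  · ext i j
    fin_cases i <;> fin_cases j <;>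
      simp [Matrix.mul_apply, Fin.sum_univ_two, star_eq_conjTranspose] at h' ⊢ <;>
      grind
  · simp [det_fin_two] at h' ⊢
    linear_combination h'

/-- The Hopf map sends the first column of a matrix `U ∈ SU(2)` to the unit sphere of `ℝ³`; this is
its height coordinate. -/
def hopfHeight (U : Matrix (Fin 2) (Fin 2) ℂ) : ℝ :=
  Complex.normSq (U 0 0) - Complex.normSq (U 1 0)

/-- The horizontal coordinates of the Hopf map, as a complex number. -/
def hopfHorizontal (U : Matrix (Fin 2) (Fin 2) ℂ) : ℂ :=
  2 * (U 0 0 * star (U 1 0))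

theorem continuous_hopfHeight : Continuous hopfHeight := by
  unfold hopfHeight
  fun_prop

theorem continuous_hopfHorizontal : Continuous hopfHorizontal := by
  unfold hopfHorizontal
  fun_prop

theorem normSq_add_normSq_row {U : Matrix (Fin 2) (Fin 2) ℂ}
    (hU : U ∈ specialUnitaryGroup (Fin 2) ℂ) :
    Complex.normSq (U 0 0) + Complex.normSq (U 0 1) = 1 := by
  have h := congrFun₂ (mem_unitaryGroup_iff.1 (mem_specialUnitaryGroup_iff.1 hU).1) 0 0
  simp only [Matrix.mul_apply, Fin.sum_univ_two, star_apply, one_apply_eq, RCLike.star_def,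
    Complex.mul_conj] at h
  exact_mod_cast h

theorem normSq_add_normSq_column {U : Matrix (Fin 2) (Fin 2) ℂ}
    (hU : U ∈ specialUnitaryGroup (Fin 2) ℂ) :
    Complex.normSq (U 0 0) + Complex.normSq (U 1 0) = 1 := by
  have h := congrFun₂ (mem_unitaryGroup_iff'.1 (mem_specialUnitaryGroup_iff.1 hU).1) 0 0
  simp only [Matrix.mul_apply, Fin.sum_univ_two, star_apply, one_apply_eq, RCLike.star_def,
    mul_comm _ (U _ _), Complex.mul_conj] at h
  exact_mod_cast h

theorem hopf_mem_sphere {U : Matrix (Fin 2) (Fin 2) ℂ} (hU : U ∈ specialUnitaryGroup (Fin 2) ℂ) :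
    hopfHeight U ^ 2 + (hopfHorizontal U).re ^ 2 + (hopfHorizontal U).im ^ 2 = 1 := by
  have h := normSq_add_normSq_column hU
  simp only [hopfHeight, hopfHorizontal, Complex.normSq_apply, RCLike.star_def, Complex.mul_re,
    Complex.mul_im, Complex.conj_re, Complex.conj_im, Complex.re_ofNat, Complex.im_ofNat] at h ⊢
  linear_combination
    ((U 0 0).re * (U 0 0).re + (U 0 0).im * (U 0 0).im +
      ((U 1 0).re * (U 1 0).re + (U 1 0).im * (U 1 0).im) + 1) * h

theorem re_conj_diagonal_apply_zero {U : Matrix (Fin 2) (Fin 2) ℂ}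
    (hU : U ∈ specialUnitaryGroup (Fin 2) ℂ) (α : ℝ) :
    ((U * diagonal ![(α : ℂ), -(α : ℂ)] * star U) 0 0).re = α * hopfHeight U := by
  have hrow := normSq_add_normSq_row hU
  have hcol := normSq_add_normSq_column hU
  have h : ((U * diagonal ![(α : ℂ), -(α : ℂ)] * star U) 0 0).re
      = α * (Complex.normSq (U 0 0) - Complex.normSq (U 0 1)) := by
    rw [Matrix.mul_apply, Fin.sum_univ_two]
    simp [mul_diagonal, Complex.normSq_apply]
    ring
  rw [h, hopfHeight]
  linear_combination α * (hcol - hrow)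

theorem hopfHeight_rotation_re (θ : ℝ) (U : Matrix (Fin 2) (Fin 2) ℂ) :
    hopfHeight (!![(Real.cos (θ / 2) : ℂ), (Real.sin (θ / 2) : ℂ);
        -star (Real.sin (θ / 2) : ℂ), star (Real.cos (θ / 2) : ℂ)] * U)
      = Real.cos θ * hopfHeight U + Real.sin θ * (hopfHorizontal U).re := by
  have hc : Real.cos θ = Real.cos (θ / 2) ^ 2 - Real.sin (θ / 2) ^ 2 := by
    rw [← Real.cos_two_mul']; ring_nf
  have hs : Real.sin θ = 2 * Real.sin (θ / 2) * Real.cos (θ / 2) := by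
    rw [← Real.sin_two_mul]; ring_nf
  rw [hc, hs]
  generalize Real.cos (θ / 2) = c
  generalize Real.sin (θ / 2) = s
  simp [hopfHeight, hopfHorizontal, Matrix.mul_apply, Fin.sum_univ_two, Complex.normSq_apply]
  ring

theorem hopfHeight_rotation_im (θ : ℝ) (U : Matrix (Fin 2) (Fin 2) ℂ) :
    hopfHeight (!![(Real.cos (θ / 2) : ℂ), Real.sin (θ / 2) * Complex.I;
        -star (Real.sin (θ / 2) * Complex.I), star (Real.cos (θ / 2) : ℂ)] * U)
      = Real.cos θ * hopfHeight U + Real.sin θ * (hopfHorizontal U).im := by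
  have hc : Real.cos θ = Real.cos (θ / 2) ^ 2 - Real.sin (θ / 2) ^ 2 := by
    rw [← Real.cos_two_mul']; ring_nf
  have hs : Real.sin θ = 2 * Real.sin (θ / 2) * Real.cos (θ / 2) := by
    rw [← Real.sin_two_mul]; ring_nf
  rw [hc, hs]
  generalize Real.cos (θ / 2) = c
  generalize Real.sin (θ / 2) = s
  simp [hopfHeight, hopfHorizontal, Matrix.mul_apply, Fin.sum_univ_two, Complex.normSq_apply]
  ring

/-- Schur's problem for `SU(2)`: let `D = diag(α, −α)` with `α > 0`, and let `μ` be the Haar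
probability measure of `SU(2)` (characterized as the left-translation-invariant probability
measure carried by `SU(2)`). Then the pushforward of `μ` under
`U ↦ Re((U · D · Uᴴ)₁₁)` is the uniform probability measure on `[−α, α]`,
i.e. `(2α)⁻¹` times Lebesgue measure restricted to `[−α, α]`. -/
theorem schur_SU2_pushforward_uniform
    (α : ℝ) (hα : 0 < α)
    (μ : Measure (Matrix (Fin 2) (Fin 2) ℂ)) [IsProbabilityMeasure μ]
    (hsupp : μ {U | U ∉ Matrix.specialUnitaryGroup (Fin 2) ℂ} = 0)
    (hinv : ∀ V ∈ Matrix.specialUnitaryGroup (Fin 2) ℂ,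
      Measure.map (fun U => V * U) μ = μ) :
    Measure.map (fun U : Matrix (Fin 2) (Fin 2) ℂ =>
        ((U * Matrix.diagonal ![(α : ℂ), -(α : ℂ)] * star U) 0 0).re) μ
      = (ENNReal.ofReal (2 * α))⁻¹ • volume.restrict (Set.Icc (-α) α) := by
  have hSU : ∀ᵐ U ∂μ, U ∈ specialUnitaryGroup (Fin 2) ℂ := hsupp
  have integral_translate : ∀ V ∈ specialUnitaryGroup (Fin 2) ℂ, ∀ n : ℕ,
      ∫ U, hopfHeight (V * U) ^ n ∂μ = ∫ U, hopfHeight U ^ n ∂μ := by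
    intro V hV n
    conv_rhs => rw [← hinv V hV]
    exact (integral_map (by fun_prop)
      (continuous_hopfHeight.pow n).aestronglyMeasurable).symm
  have moments := integral_pow_of_rotation (μ := μ) continuous_hopfHeight.measurable
    (Complex.continuous_re.comp continuous_hopfHorizontal).measurable
    (Complex.continuous_im.comp continuous_hopfHorizontal).measurable
    (hSU.mono fun U hU => hopf_mem_sphere hU)
    (fun n θ => by
      simp only [Function.comp_apply, ← hopfHeight_rotation_re]
      refine integral_translate _ (mem_specialUnitaryGroup_of_normSq_add_normSq ?_) n
      simp [Complex.normSq_ofReal, ← sq, -Complex.ofReal_cos, -Complex.ofReal_sin])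
    (fun n θ => by
      simp only [Function.comp_apply, ← hopfHeight_rotation_im]
      refine integral_translate _ (mem_specialUnitaryGroup_of_normSq_add_normSq ?_) n
      simp [Complex.normSq_ofReal, ← sq, -Complex.ofReal_cos, -Complex.ofReal_sin])
  have hmeas : Measurable fun U => α * hopfHeight U :=
    (continuous_const.mul continuous_hopfHeight).measurable
  rw [Measure.map_congr (hSU.mono fun U hU => re_conj_diagonal_apply_zero hU α)]
  have := isProbabilityMeasure_uniform_Icc hα
  have := Measure.isProbabilityMeasure_map (μ := μ) hmeas.aemeasurable
  refine Measure.ext_of_moments_of_Icc (a := -α) (b := α) ?_ ?_ fun n => ?_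
  · refine (ae_map_iff hmeas.aemeasurable measurableSet_Icc).2 ?_
    filter_upwards [hSU] with U hU
    have hle : |hopfHeight U| ≤ 1 := abs_le_one_iff_mul_self_le_one.2 (by
      nlinarith [hopf_mem_sphere hU, sq_nonneg (hopfHorizontal U).re,
        sq_nonneg (hopfHorizontal U).im])
    rw [← abs_le, abs_mul, abs_of_pos hα]
    exact mul_le_of_le_one_right hα.le hle
  · exact Measure.ae_smul_measure (ae_restrict_mem measurableSet_Icc) _
  · rw [integral_map hmeas.aemeasurable (by fun_prop), integral_pow_uniform_Icc hα]
    simp only [mul_pow, integral_const_mul, moments]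
end

section
/- Let α > 0 be a real number and let D = diag(α, −α) be the 2×2 real diagonal matrix with entries α and −α. Consider the map g from the special orthogonal group SO(2) to ℝ given by g(O) = (O · D · Oᵀ)_{11}. Then the pushforward of the Haar probability measure on SO(2) under g is the measure on ℝ with density x ↦ 1/(π·√(α² − x²)) with respect to Lebesgue measure on the open interval (−α, α) (and zero mass outside [−α, α]). -/
open MeasureTheory Matrix

/-- We endow the space of `2 × 2` real matrices with its Borel σ-algebra. -/
noncomputable instance : MeasurableSpace (Matrix (Fin 2) (Fin 2) ℝ) := borel _

instance : BorelSpace (Matrix (Fin 2) (Fin 2) ℝ) := ⟨rfl⟩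

/-- The substitution `x = α * cos t` turns the arcsine density on `(-α, α)` into the uniform
density on `(0, π)`. -/
theorem lintegral_arcsine_density_mul {α : ℝ} (hα : 0 < α) (h : ℝ → ENNReal) :
    ∫⁻ x in Set.Ioo (-α) α,
        ENNReal.ofReal (1 / (Real.pi * Real.sqrt (α ^ 2 - x ^ 2))) * h x =
      ENNReal.ofReal (1 / Real.pi) * ∫⁻ t in Set.Ioo 0 Real.pi, h (α * Real.cos t) := by
  have himage : (fun t => α * Real.cos t) '' Set.Ioo 0 Real.pi = Set.Ioo (-α) α := by
    ext x
    constructor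
    · rintro ⟨t, ht, rfl⟩
      obtain ⟨h₁, h₂⟩ := Real.mapsTo_cos_Ioo ht
      constructor <;> dsimp only <;> nlinarith
    · rintro ⟨h₁, h₂⟩
      have h₃ : -1 < x / α := by rw [lt_div_iff₀ hα]; linarith
      have h₄ : x / α < 1 := by rw [div_lt_one hα]; exact h₂
      refine ⟨Real.arccos (x / α), ⟨Real.arccos_pos.2 h₄, ?_⟩, ?_⟩
      · refine lt_of_le_of_ne (Real.arccos_le_pi _) fun h => ?_
        exact absurd (Real.arccos_eq_pi.1 h) (not_le.2 h₃)
      · dsimp only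
        rw [Real.cos_arccos h₃.le h₄.le, mul_div_cancel₀ _ hα.ne']
  have hinj : Set.InjOn (fun t => α * Real.cos t) (Set.Ioo 0 Real.pi) := fun x hx y hy hxy =>
    Real.injOn_cos (Set.Ioo_subset_Icc_self hx) (Set.Ioo_subset_Icc_self hy)
      (mul_left_cancel₀ hα.ne' hxy)
  have hderiv : ∀ t ∈ Set.Ioo 0 Real.pi, HasDerivWithinAt (fun t => α * Real.cos t)
      (α * -Real.sin t) (Set.Ioo 0 Real.pi) t := fun t _ =>
    ((Real.hasDerivAt_cos t).const_mul α).hasDerivWithinAt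
  rw [← himage, lintegral_image_eq_lintegral_abs_deriv_mul measurableSet_Ioo hderiv hinj,
    ← lintegral_const_mul' _ _ ENNReal.ofReal_ne_top]
  refine setLIntegral_congr_fun measurableSet_Ioo fun t ht => ?_
  have hsin : 0 < Real.sin t := Real.sin_pos_of_mem_Ioo ht
  have hsqrt : Real.sqrt (α ^ 2 - (α * Real.cos t) ^ 2) = α * Real.sin t := by
    rw [show α ^ 2 - (α * Real.cos t) ^ 2 = (α * Real.sin t) ^ 2 by
      rw [mul_pow, mul_pow, Real.sin_sq]; ring]
    exact Real.sqrt_sq (by positivity)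
  rw [hsqrt, ← mul_assoc, ← ENNReal.ofReal_mul (abs_nonneg _), mul_neg, abs_neg,
    abs_of_pos (by positivity)]
  congr 2
  field_simp

/-- Translating a periodic function does not change its integral over a period. -/
theorem Function.Periodic.setLIntegral_Ioc_comp_add_right {f : ℝ → ENNReal} {T : ℝ}
    (hf : Function.Periodic f T) (hT : 0 < T) (a c : ℝ) :
    ∫⁻ t in Set.Ioc a (a + T), f (t + c) = ∫⁻ t in Set.Ioc a (a + T), f t := by
  have hpre : (fun t => t + c) ⁻¹' Set.Ioc (a + c) (a + c + T) = Set.Ioc a (a + T) := by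
    ext t
    simp only [Set.mem_preimage, Set.mem_Ioc]
    constructor <;> rintro ⟨h₁, h₂⟩ <;> constructor <;> linarith
  rw [← hpre, (measurePreserving_add_right volume c).setLIntegral_comp_preimage_emb
    (measurableEmbedding_addRight c), hpre]
  exact (isAddFundamentalDomain_Ioc hT (a + c)).setLIntegral_eq
    (isAddFundamentalDomain_Ioc hT a) f hf.map_vadd_zmultiples

/-- Over a full period, a function of the cosine integrates to twice its integral over the
half-period `(0, π)`. -/
theorem setLIntegral_Ioc_comp_cos_add (h : ℝ → ENNReal) (c : ℝ) :
    ∫⁻ t in Set.Ioc (-Real.pi) Real.pi, h (Real.cos (t + c)) =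
      2 * ∫⁻ t in Set.Ioo 0 Real.pi, h (Real.cos t) := by
  have hper : Function.Periodic (fun t => h (Real.cos t)) (2 * Real.pi) := fun t => by
    simp only [Real.cos_add_two_pi]
  have hshift := hper.setLIntegral_Ioc_comp_add_right Real.two_pi_pos (-Real.pi) c
  rw [show -Real.pi + 2 * Real.pi = Real.pi by ring] at hshift
  have hneg : ∫⁻ t in Set.Ioo (-Real.pi) 0, h (Real.cos t) =
      ∫⁻ t in Set.Ioo 0 Real.pi, h (Real.cos t) := by
    have := (Measure.measurePreserving_neg (volume : Measure ℝ)).setLIntegral_comp_preimage_emb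
      (MeasurableEquiv.neg ℝ).measurableEmbedding (fun t => h (Real.cos t)) (Set.Ioo 0 Real.pi)
    simpa [Set.neg_preimage] using this
  rw [hshift, ← Set.Ioc_union_Ioc_eq_Ioc (neg_nonpos.2 Real.pi_pos.le) Real.pi_pos.le,
    lintegral_union measurableSet_Ioc (Set.Ioc_disjoint_Ioc_of_le le_rfl),
    setLIntegral_congr Ioo_ae_eq_Ioc.symm, setLIntegral_congr Ioo_ae_eq_Ioc.symm, hneg, two_mul]

/-- The matrix of the plane rotation of angle `t` lies in `SO(2)`. -/
theorem Matrix.rotation_mem_specialOrthogonalGroup (t : ℝ) :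
    !![Real.cos t, -Real.sin t; Real.sin t, Real.cos t] ∈
      Matrix.specialOrthogonalGroup (Fin 2) ℝ := by
  simp [Matrix.of_mem_specialOrthogonalGroup_fin_two_iff]

/-- Every element of `SO(2)` is the matrix of a plane rotation. -/
theorem Matrix.exists_eq_rotation_of_mem_specialOrthogonalGroup {O : Matrix (Fin 2) (Fin 2) ℝ}
    (hO : O ∈ Matrix.specialOrthogonalGroup (Fin 2) ℝ) :
    ∃ t : ℝ, O = !![Real.cos t, -Real.sin t; Real.sin t, Real.cos t] := by
  obtain ⟨h₁, h₂, h₃⟩ := Matrix.mem_specialOrthogonalGroup_fin_two_iff.1 hO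
  have hnorm : ‖(⟨O 0 0, O 1 0⟩ : ℂ)‖ = 1 := by
    rw [Complex.norm_def, Complex.normSq_mk, Real.sqrt_eq_one]
    rw [h₂] at h₃
    linarith
  have hcos := Complex.norm_mul_cos_arg ⟨O 0 0, O 1 0⟩
  have hsin := Complex.norm_mul_sin_arg ⟨O 0 0, O 1 0⟩
  rw [hnorm, one_mul] at hcos hsin
  refine ⟨Complex.arg ⟨O 0 0, O 1 0⟩, ?_⟩
  rw [hcos, hsin]
  ext i j
  fin_cases i <;> fin_cases j <;> simp [h₁, h₂]

/-- The top left entry of `O * diag(α, -α) * Oᵀ`. -/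
theorem Matrix.mul_diagonal_mul_transpose_zero_zero (α : ℝ) (O : Matrix (Fin 2) (Fin 2) ℝ) :
    (O * Matrix.diagonal ![α, -α] * O.transpose) 0 0 = α * (O 0 0 ^ 2 - O 0 1 ^ 2) := by
  simp [Matrix.mul_apply, Fin.sum_univ_two, Matrix.diagonal_apply]
  ring

/-- Schur's problem for `SO(2)`: let `D = diag(α, −α)` with `α > 0`, and let `μ` be the Haar
probability measure of `SO(2)` (characterized as the left-translation-invariant probability
measure carried by `SO(2)`). Then the pushforward of `μ` under `O ↦ (O · D · Oᵀ)₁₁` is the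
measure on `ℝ` with density `x ↦ 1/(π·√(α² − x²))` with respect to Lebesgue measure on the
open interval `(−α, α)` (hence with zero mass outside `[−α, α]`). -/
theorem schur_SO2_pushforward_arcsine
    (α : ℝ) (hα : 0 < α)
    (μ : Measure (Matrix (Fin 2) (Fin 2) ℝ)) [IsProbabilityMeasure μ]
    (hsupp : μ {O | O ∉ Matrix.specialOrthogonalGroup (Fin 2) ℝ} = 0)
    (hinv : ∀ V ∈ Matrix.specialOrthogonalGroup (Fin 2) ℝ,
      Measure.map (fun O => V * O) μ = μ) :
    Measure.map (fun O : Matrix (Fin 2) (Fin 2) ℝ =>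
        (O * Matrix.diagonal ![α, -α] * O.transpose) 0 0) μ
      = (volume.restrict (Set.Ioo (-α) α)).withDensity
          (fun x => ENNReal.ofReal (1 / (Real.pi * Real.sqrt (α ^ 2 - x ^ 2)))) := by
  have hentry : ∀ i j, Measurable fun O : Matrix (Fin 2) (Fin 2) ℝ => O i j := fun i j =>
    (continuous_id.matrix_elem i j).measurable
  simp only [Matrix.mul_diagonal_mul_transpose_zero_zero]
  have hg : Measurable fun O : Matrix (Fin 2) (Fin 2) ℝ => α * (O 0 0 ^ 2 - O 0 1 ^ 2) :=
    (((hentry 0 0).pow_const 2).sub ((hentry 0 1).pow_const 2)).const_mul α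
  refine Measure.ext_of_lintegral _ fun f hf => ?_
  rw [lintegral_map hf hg, lintegral_withDensity_eq_lintegral_mul _ (by fun_prop) hf]
  simp only [Pi.mul_apply]
  rw [lintegral_arcsine_density_mul hα]
  let R : ℝ → Matrix (Fin 2) (Fin 2) ℝ := fun t =>
    !![Real.cos t, -Real.sin t; Real.sin t, Real.cos t]
  let F : ℝ → Matrix (Fin 2) (Fin 2) ℝ → ENNReal := fun t O =>
    f (α * ((R (t / 2) * O) 0 0 ^ 2 - (R (t / 2) * O) 0 1 ^ 2))
  have hF : Measurable (Function.uncurry F) := by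
    have h₀ : ∀ i j, Measurable fun p : ℝ × Matrix (Fin 2) (Fin 2) ℝ => p.2 i j := fun i j =>
      (hentry i j).comp measurable_snd
    have hcos : Measurable fun p : ℝ × Matrix (Fin 2) (Fin 2) ℝ => Real.cos (p.1 / 2) := by
      fun_prop
    have hsin : Measurable fun p : ℝ × Matrix (Fin 2) (Fin 2) ℝ => Real.sin (p.1 / 2) := by
      fun_prop
    refine hf.comp (Measurable.const_mul (Measurable.sub (.pow_const ?_ 2) (.pow_const ?_ 2)) α)
    · simp only [R, Matrix.mul_apply, Fin.sum_univ_two, Matrix.of_apply, Matrix.cons_val]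
      exact (hcos.mul (h₀ 0 0)).add (hsin.neg.mul (h₀ 1 0))
    · simp only [R, Matrix.mul_apply, Fin.sum_univ_two, Matrix.of_apply, Matrix.cons_val]
      exact (hcos.mul (h₀ 0 1)).add (hsin.neg.mul (h₀ 1 1))
  have hrotate : ∀ t, ∫⁻ O, F t O ∂μ = ∫⁻ O, f (α * (O 0 0 ^ 2 - O 0 1 ^ 2)) ∂μ := fun t => by
    conv_rhs => rw [← hinv (R (t / 2)) (Matrix.rotation_mem_specialOrthogonalGroup _)]
    exact (lintegral_map (hf.comp hg)
      (continuous_const.matrix_mul continuous_id).measurable).symm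
  have haverage : ∀ᵐ O ∂μ, ∫⁻ t in Set.Ioc (-Real.pi) Real.pi, F t O =
      2 * ∫⁻ t in Set.Ioo 0 Real.pi, f (α * Real.cos t) := by
    filter_upwards [show ∀ᵐ O ∂μ, O ∈ Matrix.specialOrthogonalGroup (Fin 2) ℝ from hsupp]
      with O hO
    obtain ⟨s, rfl⟩ := Matrix.exists_eq_rotation_of_mem_specialOrthogonalGroup hO
    rw [← setLIntegral_Ioc_comp_cos_add (fun x => f (α * x)) (2 * s)]
    refine lintegral_congr fun t => ?_
    have h₁ : t + 2 * s = 2 * (t / 2 + s) := by ring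
    simp only [F, R, h₁, Real.cos_two_mul', Real.cos_add, Real.sin_add]
    congr 2
    simp [Matrix.mul_apply, Fin.sum_univ_two]
    ring
  have hswap : ∫⁻ t in Set.Ioc (-Real.pi) Real.pi, ∫⁻ O, F t O ∂μ =
      ∫⁻ O, (∫⁻ t in Set.Ioc (-Real.pi) Real.pi, F t O) ∂μ :=
    lintegral_lintegral_swap hF.aemeasurable
  rw [lintegral_congr_ae haverage] at hswap
  simp only [hrotate, lintegral_const, measure_univ, mul_one, Measure.restrict_apply_univ,
    Real.volume_Ioc] at hswap
  rw [show Real.pi - -Real.pi = 2 * Real.pi by ring, ENNReal.ofReal_mul zero_le_two,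
    ENNReal.ofReal_ofNat, mul_comm, mul_assoc] at hswap
  have hcancel := (ENNReal.mul_right_inj two_ne_zero ENNReal.ofNat_ne_top).1 hswap
  rw [← hcancel, ← mul_assoc, ← ENNReal.ofReal_mul (by positivity),
    one_div_mul_cancel Real.pi_ne_zero, ENNReal.ofReal_one, one_mul]
end

section
/- Let α_1 ≥ α_2 ≥ α_3 ≥ 0 be integers and let ξ_1, ξ_2, ξ_3 ≥ 0 be integers with ξ_1 + ξ_2 + ξ_3 = α_1 + α_2 + α_3. Then the Kostka number satisfies K_{(α_1,α_2,α_3)}(ξ_1,ξ_2,ξ_3) = max(0, 1 + min(α_1, α_1 + α_2 − ξ_1) − max(α_2, ξ_2, ξ_3, α_1 + α_3 − ξ_1)). -/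
/-- `kostka α ξ` is the Kostka number associated to the shape `α` (given by its row
lengths `α 0 ≥ α 1 ≥ …`) and the content `ξ` (for `k ≥ 1`, the entry `k` must occur
exactly `ξ k` times): it counts the fillings `T` of the Young diagram
`{(i, j) | j < α i}` with positive integers that weakly increase along rows and
strictly increase down columns, such that for each `k ≥ 1` the entry `k` occurs
exactly `ξ k` times.  (Fillings are normalized to be `0` outside the diagram.) -/
noncomputable def kostka (α : ℕ → ℕ) (ξ : ℕ → ℕ) : ℕ :=
  Nat.card {T : ℕ × ℕ → ℕ //
    (∀ i j, j + 1 < α i → T (i, j) ≤ T (i, j + 1)) ∧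
    (∀ i j, j < α (i + 1) → T (i, j) < T (i + 1, j)) ∧
    (∀ i j, j < α i → 1 ≤ T (i, j)) ∧
    (∀ i j, α i ≤ j → T (i, j) = 0) ∧
    (∀ k, 1 ≤ k → {c : ℕ × ℕ | c.2 < α c.1 ∧ T c = k}.ncard = ξ k)}

/-- The number of cells carrying the entry `k` is the sum over the rows. -/
theorem ncard_cells_eq_sum (α : ℕ → ℕ) (m : ℕ) (hα : ∀ i, m ≤ i → α i = 0)
    (T : ℕ × ℕ → ℕ) (k : ℕ) :
    {c : ℕ × ℕ | c.2 < α c.1 ∧ T c = k}.ncard =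
      ∑ i ∈ Finset.range m, ((Finset.range (α i)).filter fun j => T (i, j) = k).card := by
  rw [← Finset.card_sigma, ← Finset.card_map (Equiv.sigmaEquivProd ℕ ℕ).toEmbedding,
    ← Set.ncard_coe_finset]
  congr 1
  ext ⟨i, j⟩
  have hi : j < α i → i < m := fun h => by
    by_contra hm
    simp [hα i (not_lt.mp hm)] at h
  simp only [Set.mem_ofPred_eq, Finset.coe_map, Set.mem_image, Finset.mem_coe, Finset.mem_sigma,
    Finset.mem_range, Finset.mem_filter, Sigma.exists, Equiv.coe_toEmbedding,
    Equiv.sigmaEquivProd_apply, Prod.mk.injEq]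
  constructor
  · rintro ⟨h, hT⟩
    exact ⟨i, j, ⟨hi h, h, hT⟩, rfl, rfl⟩
  · rintro ⟨i, j, ⟨-, h, hT⟩, rfl, rfl⟩
    exact ⟨h, hT⟩

/-- The row of length `n` whose entries are `1` before column `a`, then `2` before column `b`,
then `3`; it is `0` outside the row. -/
def thresholdRow (a b n j : ℕ) : ℕ :=
  if j < a then 1 else if j < b then 2 else if j < n then 3 else 0

theorem card_thresholdRow_eq {a b n : ℕ} (hab : a ≤ b) (hbn : b ≤ n) (k : ℕ) (hk : 1 ≤ k) :
    ((Finset.range n).filter fun j => thresholdRow a b n j = k).card =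
      [0, a, b - a, n - b].getD k 0 := by
  have key : ∀ l u, (∀ j, (j < n ∧ thresholdRow a b n j = k) ↔ l ≤ j ∧ j < u) →
      ((Finset.range n).filter fun j => thresholdRow a b n j = k).card = u - l := by
    intro l u h
    rw [← Nat.card_Ico]
    congr 1
    ext j
    simpa using h j
  unfold thresholdRow at *
  match k, hk with
  | 1, _ => simpa using key 0 a (fun j => by split_ifs <;> omega)
  | 2, _ => simpa using key a b (fun j => by split_ifs <;> omega)
  | 3, _ => simpa using key b n (fun j => by split_ifs <;> omega)
  | k + 4, _ => simpa using key 0 0 (fun j => by split_ifs <;> omega)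

/-- A property of the columns of a row which is closed under moving left holds exactly on an
initial segment. -/
theorem exists_threshold (n : ℕ) (P : ℕ → Prop) (hP : ∀ j, j + 1 < n → P (j + 1) → P j) :
    ∃ a ≤ n, ∀ j < n, P j ↔ j < a := by
  induction n with
  | zero => exact ⟨0, le_rfl, by simp⟩
  | succ n ih =>
    obtain ⟨a, han, ha⟩ := ih fun j hj => hP j (by omega)
    by_cases hn : P n
    · have han' : a = n := by
        by_contra hne
        obtain ⟨m, rfl⟩ : ∃ m, n = m + 1 := ⟨n - 1, by omega⟩
        have := (ha m (by omega)).mp (hP m (by omega) hn)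
        omega
      subst han'
      refine ⟨a + 1, le_rfl, fun j hj => ⟨fun _ => hj, fun _ => ?_⟩⟩
      rcases Nat.lt_succ_iff_lt_or_eq.mp hj with h | rfl
      · exact (ha j h).mpr h
      · exact hn
    · refine ⟨a, by omega, fun j hj => ?_⟩
      rcases Nat.lt_succ_iff_lt_or_eq.mp hj with h | rfl
      · exact ha j h
      · exact ⟨fun h => absurd h hn, fun h => by omega⟩

/-- A weakly increasing row with entries in `{1, 2, 3}` is a threshold row. -/
theorem exists_eq_thresholdRow (n : ℕ) (f : ℕ → ℕ) (hmono : ∀ j, j + 1 < n → f j ≤ f (j + 1))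
    (hpos : ∀ j < n, 1 ≤ f j) (hle : ∀ j < n, f j ≤ 3) (hzero : ∀ j, n ≤ j → f j = 0) :
    ∃ a b, a ≤ b ∧ b ≤ n ∧ ∀ j, f j = thresholdRow a b n j := by
  obtain ⟨a, han, ha⟩ := exists_threshold n (fun j => f j ≤ 1)
    fun j hj h => (hmono j hj).trans h
  obtain ⟨b, hbn, hb⟩ := exists_threshold n (fun j => f j ≤ 2)
    fun j hj h => (hmono j hj).trans h
  refine ⟨a, b, ?_, hbn, fun j => ?_⟩
  · by_contra hab
    have h1 := (ha b (by omega)).mpr (by omega)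
    have h2 := (hb b (by omega)).mp (by omega)
    omega
  · unfold thresholdRow
    by_cases hj : j < n
    · have := ha j hj
      have := hb j hj
      have := hpos j hj
      have := hle j hj
      split_ifs <;> omega
    · have := hzero j (by omega)
      split_ifs <;> omega

/-- The filling of a three-row shape with `a` ones and last `2` before column `p` in the first row,
`q` twos in the second row, and threes elsewhere. -/
def threeRowFilling (α₁ α₂ α₃ a p q : ℕ) : ℕ × ℕ → ℕ
  | (0, j) => thresholdRow a p α₁ j
  | (1, j) => thresholdRow 0 q α₂ j
  | (2, j) => thresholdRow 0 0 α₃ j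
  | (_ + 3, _) => 0

/-- The middle-row parameters `p` of the Gelfand–Tsetlin patterns with top row `α₁, α₂, α₃`,
middle row `p, ξ₁ + ξ₂ - p` and bottom row `ξ₁`. -/
def IsMiddleEntry (α₁ α₂ α₃ ξ₁ ξ₂ p : ℕ) : Prop :=
  α₂ ≤ p ∧ p ≤ α₁ ∧ ξ₁ ≤ p ∧ ξ₂ ≤ p ∧ ξ₁ + ξ₂ ≤ p + α₂ ∧ p + α₃ ≤ ξ₁ + ξ₂

/-- The conditions defining the tableaux counted by `kostka α ξ`. -/
def IsTableau (α ξ : ℕ → ℕ) (T : ℕ × ℕ → ℕ) : Prop :=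
  (∀ i j, j + 1 < α i → T (i, j) ≤ T (i, j + 1)) ∧
  (∀ i j, j < α (i + 1) → T (i, j) < T (i + 1, j)) ∧
  (∀ i j, j < α i → 1 ≤ T (i, j)) ∧
  (∀ i j, α i ≤ j → T (i, j) = 0) ∧
  (∀ k, 1 ≤ k → {c : ℕ × ℕ | c.2 < α c.1 ∧ T c = k}.ncard = ξ k)

theorem getD_three_eq_zero (a b c : ℕ) (i : ℕ) (hi : 3 ≤ i) : [a, b, c].getD i 0 = 0 := by
  rw [List.getD_eq_default]
  simpa using hi

theorem isTableau_threeRowFilling {α₁ α₂ α₃ ξ₁ ξ₂ ξ₃ p : ℕ}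
    (hsum : ξ₁ + ξ₂ + ξ₃ = α₁ + α₂ + α₃)
    (hp : IsMiddleEntry α₁ α₂ α₃ ξ₁ ξ₂ p) :
    IsTableau (fun i => [α₁, α₂, α₃].getD i 0) (fun k => [0, ξ₁, ξ₂, ξ₃].getD k 0)
      (threeRowFilling α₁ α₂ α₃ ξ₁ p (ξ₁ + ξ₂ - p)) := by
  obtain ⟨h1, h2, h3, h4, h5, h6⟩ := hp
  refine ⟨fun i j => ?_, fun i j => ?_, fun i j => ?_, fun i j => ?_, fun k hk => ?_⟩
  · match i with
    | 0 | 1 | 2 => simp [threeRowFilling, thresholdRow]; split_ifs <;> omega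
    | i + 3 => simp
  · match i with
    | 0 | 1 => simp [threeRowFilling, thresholdRow]; split_ifs <;> omega
    | i + 2 => simp
  · match i with
    | 0 | 1 | 2 => simp [threeRowFilling, thresholdRow]; split_ifs <;> omega
    | i + 3 => simp
  · match i with
    | 0 | 1 => simp [threeRowFilling, thresholdRow]; split_ifs <;> omega
    | 2 => simp +contextual [threeRowFilling, thresholdRow]
    | i + 3 => simp [threeRowFilling]
  · rw [ncard_cells_eq_sum _ 3 (getD_three_eq_zero α₁ α₂ α₃)]
    simp only [Finset.sum_range_succ, Finset.sum_range_zero, threeRowFilling,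
      List.getD_cons_zero, List.getD_cons_succ]
    rw [card_thresholdRow_eq h3 h2 k hk, card_thresholdRow_eq (Nat.zero_le _) (by omega) k hk,
      card_thresholdRow_eq (Nat.zero_le _) (by omega) k hk]
    match k, hk with
    | 1, _ | 2, _ | 3, _ => simp <;> omega
    | k + 4, _ => simp

theorem IsTableau.exists_eq_threeRowFilling {α₁ α₂ α₃ ξ₁ ξ₂ ξ₃ : ℕ} {T : ℕ × ℕ → ℕ}
    (h12 : α₂ ≤ α₁) (h23 : α₃ ≤ α₂)
    (hT : IsTableau (fun i => [α₁, α₂, α₃].getD i 0) (fun k => [0, ξ₁, ξ₂, ξ₃].getD k 0) T) :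
    ∃ p, IsMiddleEntry α₁ α₂ α₃ ξ₁ ξ₂ p ∧
      T = threeRowFilling α₁ α₂ α₃ ξ₁ p (ξ₁ + ξ₂ - p) := by
  obtain ⟨hrow, hcol, hpos, hzero, hcard⟩ := hT
  have hcount := fun k hk =>
    (ncard_cells_eq_sum _ 3 (getD_three_eq_zero α₁ α₂ α₃) T k).symm.trans (hcard k hk)
  simp only [Finset.sum_range_succ, Finset.sum_range_zero, List.getD_cons_zero,
    List.getD_cons_succ, zero_add] at hcount
  have hle : ∀ i j, j < [α₁, α₂, α₃].getD i 0 → T (i, j) ≤ 3 := by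
    intro i j hj
    by_contra! h
    obtain ⟨k, hk⟩ := Nat.exists_eq_add_of_le' h
    have h0 := hcount (k + 4) (by omega)
    simp only [List.getD_cons_succ, List.getD_nil, Nat.add_eq_zero_iff, Finset.card_eq_zero,
      Finset.filter_eq_empty_iff, Finset.mem_range] at h0
    match i with
    | 0 => exact h0.1.1 hj hk
    | 1 => exact h0.1.2 hj hk
    | 2 => exact h0.2 hj hk
    | i + 3 => simp at hj
  obtain ⟨a, p, hap, hpn, hr0⟩ := exists_eq_thresholdRow α₁ (fun j => T (0, j)) (hrow 0)
    (hpos 0) (hle 0) (hzero 0)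
  obtain ⟨b, q, hbq, hqn, hr1⟩ := exists_eq_thresholdRow α₂ (fun j => T (1, j)) (hrow 1)
    (hpos 1) (hle 1) (hzero 1)
  obtain ⟨c, d, hcd, hdn, hr2⟩ := exists_eq_thresholdRow α₃ (fun j => T (2, j)) (hrow 2)
    (hpos 2) (hle 2) (hzero 2)
  have hc0 : ∀ j, j < α₂ → thresholdRow a p α₁ j < thresholdRow b q α₂ j := fun j hj => by
    rw [← hr0, ← hr1]; exact hcol 0 j hj
  have hc1 : ∀ j, j < α₃ → thresholdRow b q α₂ j < thresholdRow c d α₃ j := fun j hj => by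
    rw [← hr1, ← hr2]; exact hcol 1 j hj
  simp only [hr0, hr1, hr2] at hcount
  have hcount' : ∀ k, 1 ≤ k → [0, a, p - a, α₁ - p].getD k 0 + [0, b, q - b, α₂ - q].getD k 0 +
      [0, c, d - c, α₃ - d].getD k 0 = [0, ξ₁, ξ₂, ξ₃].getD k 0 := fun k hk => by
    rw [← hcount k hk, card_thresholdRow_eq hap hpn k hk, card_thresholdRow_eq hbq hqn k hk,
      card_thresholdRow_eq hcd hdn k hk]
  have e1 := hcount' 1 le_rfl
  have e2 := hcount' 2 (by omega)
  simp only [List.getD_cons_succ, List.getD_cons_zero] at e1 e2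
  unfold thresholdRow at hc0 hc1
  have hb : b = 0 := by
    by_contra hb
    have := hc0 0 (by omega)
    split_ifs at this <;> omega
  subst hb
  have hd : d = 0 := by
    by_contra hd
    have h0 := hc0 0 (by omega)
    have h1 := hc1 0 (by omega)
    split_ifs at h0 h1 <;> omega
  subst hd
  obtain rfl : c = 0 := by omega
  have hqa : q ≤ a := by
    by_contra hqa
    have := hc0 a (by omega)
    split_ifs at this <;> omega
  have hpα : α₂ ≤ p := by
    by_contra hpα
    have := hc0 p (by omega)
    split_ifs at this <;> omega
  have hqα : α₃ ≤ q := by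
    by_contra hqα
    have := hc1 q (by omega)
    split_ifs at this <;> omega
  obtain rfl : a = ξ₁ := by omega
  obtain rfl : q = a + ξ₂ - p := by omega
  refine ⟨p, by unfold IsMiddleEntry; omega, ?_⟩
  funext ⟨i, j⟩
  match i with
  | 0 => exact hr0 j
  | 1 => exact hr1 j
  | 2 => exact hr2 j
  | i + 3 => exact hzero (i + 3) j (by simp)

theorem threeRowFilling_injOn {α₁ α₂ α₃ ξ₁ ξ₂ p p' : ℕ}
    (hp : IsMiddleEntry α₁ α₂ α₃ ξ₁ ξ₂ p) (hp' : IsMiddleEntry α₁ α₂ α₃ ξ₁ ξ₂ p')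
    (h : threeRowFilling α₁ α₂ α₃ ξ₁ p (ξ₁ + ξ₂ - p) =
      threeRowFilling α₁ α₂ α₃ ξ₁ p' (ξ₁ + ξ₂ - p')) : p = p' := by
  have h1 : thresholdRow ξ₁ p α₁ p = thresholdRow ξ₁ p' α₁ p := congrFun h (0, p)
  have h2 : thresholdRow ξ₁ p α₁ p' = thresholdRow ξ₁ p' α₁ p' := congrFun h (0, p')
  unfold IsMiddleEntry at hp hp'
  unfold thresholdRow at h1 h2
  split_ifs at h1 h2 <;> omega

theorem kostka_three_rows_eq_card {α₁ α₂ α₃ ξ₁ ξ₂ ξ₃ : ℕ}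
    (h12 : α₂ ≤ α₁) (h23 : α₃ ≤ α₂) (hsum : ξ₁ + ξ₂ + ξ₃ = α₁ + α₂ + α₃) :
    kostka (fun i => [α₁, α₂, α₃].getD i 0) (fun k => [0, ξ₁, ξ₂, ξ₃].getD k 0) =
      Nat.card {p // IsMiddleEntry α₁ α₂ α₃ ξ₁ ξ₂ p} := by
  symm
  refine Nat.card_congr (Equiv.ofBijective
    (fun p => ⟨_, isTableau_threeRowFilling hsum p.2⟩) ⟨?_, ?_⟩)
  · intro p p' h
    exact Subtype.ext (threeRowFilling_injOn p.2 p'.2 (congrArg Subtype.val h))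
  · rintro ⟨T, hT⟩
    obtain ⟨p, hp, rfl⟩ := IsTableau.exists_eq_threeRowFilling h12 h23 hT
    exact ⟨⟨p, hp⟩, rfl⟩

theorem card_isMiddleEntry {α₁ α₂ α₃ ξ₁ ξ₂ : ℕ} (h23 : α₃ ≤ α₂) :
    Nat.card {p // IsMiddleEntry α₁ α₂ α₃ ξ₁ ξ₂ p} =
      min α₁ (ξ₁ + ξ₂ - α₃) + 1 - max α₂ (max ξ₁ (max ξ₂ (ξ₁ + ξ₂ - α₂))) := by
  rw [← Nat.card_Icc]
  refine Nat.subtype_card _ fun p => ?_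
  rw [Finset.mem_Icc, IsMiddleEntry]
  omega

/-- The `su(3)` Kostka number formula: for a partition `α₁ ≥ α₂ ≥ α₃ ≥ 0` and a content
`(ξ₁, ξ₂, ξ₃)` with `ξ₁ + ξ₂ + ξ₃ = α₁ + α₂ + α₃`,
`K_α(ξ) = max(0, 1 + min(α₁, α₁+α₂−ξ₁) − max(α₂, ξ₂, ξ₃, α₁+α₃−ξ₁))`. -/
theorem kostka_su3_formula
    (α₁ α₂ α₃ ξ₁ ξ₂ ξ₃ : ℕ) (h12 : α₂ ≤ α₁) (h23 : α₃ ≤ α₂)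
    (hsum : ξ₁ + ξ₂ + ξ₃ = α₁ + α₂ + α₃) :
    (kostka (fun i => [α₁, α₂, α₃].getD i 0) (fun k => [0, ξ₁, ξ₂, ξ₃].getD k 0) : ℤ)
      = max 0 (1 + min (α₁ : ℤ) (α₁ + α₂ - ξ₁)
          - max (α₂ : ℤ) (max (ξ₂ : ℤ) (max (ξ₃ : ℤ) (α₁ + α₃ - ξ₁)))) := by
  rw [kostka_three_rows_eq_card h12 h23 hsum, card_isMiddleEntry h23]
  omega
end

section
/- Let α_1 ≥ α_2 ≥ α_3 be real numbers and let ξ_1, ξ_2, ξ_3 be real numbers with ξ_1 + ξ_2 + ξ_3 = α_1 + α_2 + α_3. Then min(α_1, α_1 + α_2 − ξ_1) − max(α_2, ξ_2, ξ_3, α_1 + α_3 − ξ_1) = min of the eight quantities {α_1 − α_2, α_2 − α_3, α_1 − ξ_1, α_1 − ξ_2, α_1 − ξ_3, ξ_1 − α_3, ξ_2 − α_3, ξ_3 − α_3}. In particular, the left-hand expression is a symmetric function of (ξ_1, ξ_2, ξ_3). -/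
/-- The SU(3) Schur volume identity: for `α₁ ≥ α₂ ≥ α₃` and `ξ₁ + ξ₂ + ξ₃ = α₁ + α₂ + α₃`,
`min(α₁, α₁+α₂−ξ₁) − max(α₂, ξ₂, ξ₃, α₁+α₃−ξ₁)` equals the minimum of the eight quantities
`α₁−α₂, α₂−α₃, α₁−ξ₁, α₁−ξ₂, α₁−ξ₃, ξ₁−α₃, ξ₂−α₃, ξ₃−α₃`. -/
theorem schur_volume_su3_identity
    (α₁ α₂ α₃ ξ₁ ξ₂ ξ₃ : ℝ) (h12 : α₂ ≤ α₁) (h23 : α₃ ≤ α₂)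
    (hsum : ξ₁ + ξ₂ + ξ₃ = α₁ + α₂ + α₃) :
    min α₁ (α₁ + α₂ - ξ₁) - max α₂ (max ξ₂ (max ξ₃ (α₁ + α₃ - ξ₁)))
      = min (α₁ - α₂) (min (α₂ - α₃) (min (α₁ - ξ₁) (min (α₁ - ξ₂) (min (α₁ - ξ₃)
          (min (ξ₁ - α₃) (min (ξ₂ - α₃) (ξ₃ - α₃))))))) := by
  refine eq_of_forall_le_iff fun z => ?_
  rw [le_sub_iff_add_le]
  simp only [le_min_iff, ← le_sub_iff_add_le', max_le_iff]
  constructor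
  · rintro ⟨⟨_, _, _, _⟩, _, _, _, _⟩
    refine ⟨?_, ?_, ?_, ?_, ?_, ?_, ?_, ?_⟩ <;> linarith
  · rintro ⟨_, _, _, _, _, _, _, _⟩
    refine ⟨⟨?_, ?_, ?_, ?_⟩, ?_, ?_, ?_, ?_⟩ <;> linarith
end

section
/- For natural numbers k_1, k_2, k_3, let N(k_1,k_2,k_3) denote the number of 6-tuples (a,b,c,d,e,f) of natural numbers satisfying a + d + f = k_1, b + d + e + f = k_2, and c + e + f = k_3. If k_2 ≤ k_1 and k_2 ≤ k_3, then N(k_1,k_2,k_3) = (k_2+1)(k_2+2)(k_2+3)/6. -/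
/-- The Kostant partition function of the root system `A₃`, counting decompositions
`k₁α₁ + k₂α₂ + k₃α₃ = a·α₁ + b·α₂ + c·α₃ + d·(α₁+α₂) + e·(α₂+α₃) + f·(α₁+α₂+α₃)`
with nonnegative integer coefficients `(a,b,c,d,e,f)`. -/
noncomputable def kostantA3 (k₁ k₂ k₃ : ℕ) : ℕ :=
  Nat.card {t : ℕ × ℕ × ℕ × ℕ × ℕ × ℕ //
    t.1 + t.2.2.2.1 + t.2.2.2.2.2 = k₁ ∧
    t.2.1 + t.2.2.2.1 + t.2.2.2.2.1 + t.2.2.2.2.2 = k₂ ∧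
    t.2.2.1 + t.2.2.2.2.1 + t.2.2.2.2.2 = k₃}

/-- When `k₂` is at most `k₁` and `k₃`, a decomposition is determined by its coefficients
`(d, e, f)`, which range over the triples with `d + e + f ≤ k₂`. -/
def decompositionEquiv (k₁ k₂ k₃ : ℕ) (h1 : k₂ ≤ k₁) (h3 : k₂ ≤ k₃) :
    {t : ℕ × ℕ × ℕ × ℕ × ℕ × ℕ //
      t.1 + t.2.2.2.1 + t.2.2.2.2.2 = k₁ ∧
      t.2.1 + t.2.2.2.1 + t.2.2.2.2.1 + t.2.2.2.2.2 = k₂ ∧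
      t.2.2.1 + t.2.2.2.2.1 + t.2.2.2.2.2 = k₃} ≃
    (Σ d : Fin (k₂ + 1), Σ e : Fin (k₂ - d + 1), Fin (k₂ - d - e + 1)) where
  toFun t := ⟨⟨t.1.2.2.2.1, by have := t.2; omega⟩, ⟨t.1.2.2.2.2.1, by have := t.2; grind⟩,
    ⟨t.1.2.2.2.2.2, by have := t.2; grind⟩⟩
  invFun s := ⟨(k₁ - s.1 - s.2.2, k₂ - s.1 - s.2.1 - s.2.2, k₃ - s.2.1 - s.2.2,
    s.1, s.2.1, s.2.2), by
      have hd := s.1.2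
      have he := s.2.1.2
      have hf := s.2.2.2
      dsimp only
      omega⟩
  left_inv := by
    rintro ⟨⟨a, b, c, d, e, f⟩, h⟩
    dsimp only at h
    simp only [Subtype.mk.injEq, Prod.mk.injEq, and_true]
    omega
  right_inv _ := rfl

theorem sum_range_sub_add_one {M : Type*} [AddCommMonoid M] (g : ℕ → M) (n : ℕ) :
    ∑ i ∈ Finset.range (n + 1), g (n - i) = ∑ i ∈ Finset.range (n + 1), g i := by
  simpa using Finset.sum_range_reflect g (n + 1)

theorem two_mul_sum_range_add_one (n : ℕ) :
    2 * ∑ i ∈ Finset.range (n + 1), (i + 1) = (n + 1) * (n + 2) := by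
  induction n with
  | zero => simp
  | succ n ih => rw [Finset.sum_range_succ, mul_add, ih]; ring

theorem six_mul_sum_range_sum_range (n : ℕ) :
    6 * ∑ i ∈ Finset.range (n + 1), ∑ j ∈ Finset.range (i + 1), (j + 1) =
      (n + 1) * (n + 2) * (n + 3) := by
  induction n with
  | zero => simp
  | succ n ih =>
    rw [Finset.sum_range_succ, mul_add, ih]
    linear_combination 3 * two_mul_sum_range_add_one (n + 1)

/-- If `k₂ ≤ k₁` and `k₂ ≤ k₃`, then the `A₃` Kostant partition function equals
`(k₂+1)(k₂+2)(k₂+3)/6`. -/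
theorem kostant_partition_A3_case1 (k₁ k₂ k₃ : ℕ) (h1 : k₂ ≤ k₁) (h3 : k₂ ≤ k₃) :
    6 * kostantA3 k₁ k₂ k₃ = (k₂ + 1) * (k₂ + 2) * (k₂ + 3) := by
  rw [kostantA3, Nat.card_congr (decompositionEquiv k₁ k₂ k₃ h1 h3), Nat.card_eq_fintype_card]
  simp only [Fintype.card_sigma, Fintype.card_fin]
  rw [← six_mul_sum_range_sum_range,
    ← sum_range_sub_add_one (fun i => ∑ j ∈ Finset.range (i + 1), (j + 1)), Finset.sum_range]
  congr 1
  refine Finset.sum_congr rfl fun d _ => ?_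
  rw [← sum_range_sub_add_one (fun j => j + 1), Finset.sum_range]
end

section
/- For natural numbers k_1, k_2, k_3, let N(k_1,k_2,k_3) denote the number of 6-tuples (a,b,c,d,e,f) of natural numbers satisfying a + d + f = k_1, b + d + e + f = k_2, and c + e + f = k_3. If k_1 ≤ k_2 ≤ k_3, then N(k_1,k_2,k_3) = (k_1+1)(k_1+2)(3k_2 − 2k_1 + 3)/6. -/
/-- When `k₁ ≤ k₂ ≤ k₃`, a decomposition is determined by `s = d + f ≤ k₁`, `f ≤ s` and
`e ≤ k₂ - s`, which can be chosen freely. -/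
theorem kostantA3_eq_sum {k₁ k₂ k₃ : ℕ} (h1 : k₁ ≤ k₂) (h2 : k₂ ≤ k₃) :
    kostantA3 k₁ k₂ k₃ = ∑ s ∈ Finset.range (k₁ + 1), (s + 1) * (k₂ - s + 1) := by
  let S : Finset (Σ _ : ℕ, ℕ × ℕ) :=
    (Finset.range (k₁ + 1)).sigma fun s => Finset.range (s + 1) ×ˢ Finset.range (k₂ - s + 1)
  have hS : S.card = ∑ s ∈ Finset.range (k₁ + 1), (s + 1) * (k₂ - s + 1) := by
    simp [S, Finset.card_sigma]
  rw [← hS, ← Nat.card_eq_finsetCard]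
  refine Nat.card_congr
    { toFun := fun t => ⟨⟨t.1.2.2.2.1 + t.1.2.2.2.2.2, t.1.2.2.2.2.2, t.1.2.2.2.2.1⟩, ?_⟩
      invFun := fun u => ⟨(k₁ - u.1.1, k₂ - u.1.1 - u.1.2.2, k₃ - u.1.2.2 - u.1.2.1,
        u.1.1 - u.1.2.1, u.1.2.2, u.1.2.1), ?_⟩
      left_inv := ?_
      right_inv := ?_ }
  · obtain ⟨⟨a, b, c, d, e, f⟩, h⟩ := t
    simp only [S, Finset.mem_sigma, Finset.mem_product, Finset.mem_range] at h ⊢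
    omega
  · obtain ⟨⟨s, f, e⟩, h⟩ := u
    simp only [S, Finset.mem_sigma, Finset.mem_product, Finset.mem_range] at h ⊢
    omega
  · rintro ⟨⟨a, b, c, d, e, f⟩, h⟩
    simp only [Subtype.mk.injEq, Prod.mk.injEq] at h ⊢
    refine ⟨?_, ?_, ?_, ?_, trivial⟩ <;> omega
  · rintro ⟨⟨s, f, e⟩, h⟩
    simp only [S, Finset.mem_sigma, Finset.mem_product, Finset.mem_range] at h
    have hs : s - f + f = s := by omega
    simp only [hs]

/-- Closed form of the sum `∑ (s + 1) (k - s + 1)` over `s ≤ n`, for `n ≤ k`. -/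
theorem six_mul_sum_range_succ_mul_sub {n k : ℕ} (h : n ≤ k) :
    6 * ∑ s ∈ Finset.range (n + 1), (s + 1) * (k - s + 1) =
      (n + 1) * (n + 2) * (3 * k - 2 * n + 3) := by
  induction n with
  | zero => simp; ring
  | succ n ih =>
    obtain ⟨m, rfl⟩ := Nat.exists_eq_add_of_le h
    rw [Finset.sum_range_succ, mul_add, ih (by omega),
      show n + 1 + m - (n + 1) = m by omega,
      show 3 * (n + 1 + m) - 2 * n = n + 3 * m + 3 by omega,
      show 3 * (n + 1 + m) - 2 * (n + 1) = n + 3 * m + 1 by omega]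
    ring

/-- If `k₁ ≤ k₂ ≤ k₃`, then the `A₃` Kostant partition function equals
`(k₁+1)(k₁+2)(3k₂ − 2k₁ + 3)/6`. -/
theorem kostant_partition_A3_case2 (k₁ k₂ k₃ : ℕ) (h1 : k₁ ≤ k₂) (h2 : k₂ ≤ k₃) :
    6 * kostantA3 k₁ k₂ k₃ = (k₁ + 1) * (k₁ + 2) * (3 * k₂ - 2 * k₁ + 3) := by
  rw [kostantA3_eq_sum h1 h2, six_mul_sum_range_succ_mul_sub h1]
end

section
/- For natural numbers k_1, k_2, let M(k_1,k_2) denote the number of 4-tuples (a,b,c,d) of natural numbers satisfying a + c + d = k_1 and b + c + 2d = k_2, and let b(x) = (x + 1 − ⌊(x+1)/2⌋)·(⌊(x+1)/2⌋ + 1). If k_2 ≤ k_1, then M(k_1,k_2) = b(k_2). -/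
/-- The Kostant partition function of the root system `B₂`, counting decompositions
`k₁α₁ + k₂α₂ = a·α₁ + b·α₂ + c·(α₁+α₂) + d·(α₁+2α₂)` with nonnegative integer
coefficients `(a,b,c,d)`. -/
noncomputable def kostantB2 (k₁ k₂ : ℕ) : ℕ :=
  Nat.card {t : ℕ × ℕ × ℕ × ℕ //
    t.1 + t.2.2.1 + t.2.2.2 = k₁ ∧
    t.2.1 + t.2.2.1 + 2 * t.2.2.2 = k₂}

/-- The auxiliary function `b(x) = (x + 1 − ⌊(x+1)/2⌋)·(⌊(x+1)/2⌋ + 1)`. -/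
def bAux (x : ℕ) : ℕ := (x + 1 - (x + 1) / 2) * ((x + 1) / 2 + 1)

/-- The function `b` counts the pairs `(c, d)` with `c + 2d ≤ k`, grouped by `d`. -/
lemma sum_range_eq_bAux (k : ℕ) :
    ∑ d ∈ Finset.range (k / 2 + 1), (k + 1 - 2 * d) = bAux k := by
  induction k using Nat.twoStepInduction with
  | zero => rfl
  | one => rfl
  | more k ih _ =>
    rw [show (k + 2) / 2 + 1 = k / 2 + 1 + 1 by omega, Finset.sum_range_succ']
    have hshift (d : ℕ) : k + 2 + 1 - 2 * (d + 1) = k + 1 - 2 * d := by omega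
    simp only [hshift, ih, bAux]
    rw [show (k + 2 + 1) / 2 = (k + 1) / 2 + 1 by omega]
    obtain ⟨q, hq⟩ : ∃ q, q = (k + 1) / 2 := ⟨_, rfl⟩
    obtain ⟨r, hr⟩ : ∃ r, k + 1 = q + r := ⟨k + 1 - q, by omega⟩
    rw [← hq, show k + 1 - q = r by omega, show k + 2 + 1 - (q + 1) = r + 1 by omega,
      show k + 2 + 1 - 2 * 0 = q + r + 2 by omega]
    ring

/-- When `k₂ ≤ k₁`, a decomposition is determined by its coefficients `d ≤ k₂ / 2` and
`c ≤ k₂ - 2d`, which can be chosen freely. -/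
def kostantB2Equiv {k₁ k₂ : ℕ} (h : k₂ ≤ k₁) :
    {t : ℕ × ℕ × ℕ × ℕ //
      t.1 + t.2.2.1 + t.2.2.2 = k₁ ∧ t.2.1 + t.2.2.1 + 2 * t.2.2.2 = k₂} ≃
    (d : Fin (k₂ / 2 + 1)) × Fin (k₂ + 1 - 2 * d) where
  toFun t := ⟨⟨t.1.2.2.2, by have := t.2; omega⟩, ⟨t.1.2.2.1, by have := t.2; dsimp only; omega⟩⟩
  invFun p := ⟨(k₁ - p.2 - p.1, k₂ - p.2 - 2 * p.1, p.2, p.1), by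
    have := p.1.2
    have := p.2.2
    dsimp only
    omega⟩
  left_inv := by
    rintro ⟨⟨a, b, c, d⟩, h₁, h₂⟩
    simp only [Subtype.mk.injEq, Prod.mk.injEq, and_true] at h₁ h₂ ⊢
    omega
  right_inv _ := rfl

/-- If `k₂ ≤ k₁`, then the `B₂` Kostant partition function equals `b(k₂)`. -/
theorem kostant_partition_B2_case1 (k₁ k₂ : ℕ) (h : k₂ ≤ k₁) :
    kostantB2 k₁ k₂ = bAux k₂ := by
  rw [kostantB2, Nat.card_congr (kostantB2Equiv h), Nat.card_eq_fintype_card, Fintype.card_sigma]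
  simp only [Fintype.card_fin]
  rw [Fin.sum_univ_eq_sum_range (fun d => k₂ + 1 - 2 * d), sum_range_eq_bAux]
end

section
/- For natural numbers k_1, k_2, let M(k_1,k_2) denote the number of 4-tuples (a,b,c,d) of natural numbers satisfying a + c + d = k_1 and b + c + 2d = k_2, and let b(x) = (x + 1 − ⌊(x+1)/2⌋)·(⌊(x+1)/2⌋ + 1), defined for integers x (note b(−1) = 0). If k_1 ≤ k_2 ≤ 2k_1, then M(k_1,k_2) = (k_1+1)(k_1+2)/2 − b(2k_1 − k_2 − 1). -/
/-- The auxiliary function `b(x) = (x + 1 − ⌊(x+1)/2⌋)·(⌊(x+1)/2⌋ + 1)` on the integers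
(note `b(−1) = 0`); here `/` is integer floor division (the divisor `2` is positive). -/
def bAuxInt (x : ℤ) : ℤ := (x + 1 - (x + 1) / 2) * ((x + 1) / 2 + 1)

/-- Parametrizing by `e = k₁ - d`, the coefficient `c` ranges over an initial segment of `ℕ`. -/
theorem kostantB2_eq_sum (k₁ k₂ : ℕ) (h2 : k₂ ≤ 2 * k₁) :
    kostantB2 k₁ k₂ =
      ∑ e ∈ Finset.range (k₁ + 1), min (e + 1) (2 * e + 1 - (2 * k₁ - k₂)) := by
  let e : {t : ℕ × ℕ × ℕ × ℕ //
      t.1 + t.2.2.1 + t.2.2.2 = k₁ ∧ t.2.1 + t.2.2.1 + 2 * t.2.2.2 = k₂} ≃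
      Σ e : Fin (k₁ + 1), Fin (min (e.1 + 1) (2 * e.1 + 1 - (2 * k₁ - k₂))) :=
    { toFun := fun t => ⟨⟨k₁ - t.1.2.2.2, by omega⟩, ⟨t.1.2.2.1, by
        have := t.2
        dsimp only
        omega⟩⟩
      invFun := fun s => ⟨(s.1 - s.2, k₂ - s.2 - 2 * (k₁ - s.1), s.2, k₁ - s.1), by
        have := s.1.2
        have := s.2.2
        dsimp only
        omega⟩
      left_inv := by
        rintro ⟨⟨a, b, c, d⟩, h⟩
        dsimp only at h
        simp only [Subtype.mk.injEq, Prod.mk.injEq]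
        refine ⟨?_, ?_, trivial, ?_⟩ <;> omega
      right_inv := by
        rintro ⟨⟨x, hx⟩, c, hc⟩
        have hsub : k₁ - (k₁ - x) = x := by omega
        simp only [Sigma.mk.injEq, Fin.mk.injEq]
        refine ⟨hsub, ?_⟩
        congr! 3
        rw [hsub] }
  rw [kostantB2, Nat.card_congr e, Nat.card_eq_fintype_card, Fintype.card_sigma,
    ← Fin.sum_univ_eq_sum_range fun e => min (e + 1) (2 * e + 1 - (2 * k₁ - k₂))]
  simp only [Fintype.card_fin]

/-- The sum of the positive parts of `2e + 1 - n` over `e ≤ n`. -/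
theorem sum_range_two_mul_add_one_sub (n : ℕ) :
    ∑ e ∈ Finset.range (n + 1), (2 * e + 1 - n) = (n / 2 + 1) * (n - n / 2 + 1) := by
  induction n using Nat.twoStepInduction with
  | zero => rfl
  | one => rfl
  | more n ih _ =>
    have hshift : ∀ e, 2 * (e + 1) + 1 - (n + 2) = 2 * e + 1 - n := fun e => by omega
    rw [Finset.sum_range_succ', Finset.sum_congr rfl fun e _ => hshift e,
      Finset.sum_range_succ, ih]
    obtain ⟨j, hj⟩ : ∃ j, n = n / 2 + j := ⟨n - n / 2, by omega⟩
    have hdiv : (n + 2) / 2 = n / 2 + 1 := by omega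
    have hsub : n + 2 - (n / 2 + 1) = j + 1 := by omega
    have hsub' : n - n / 2 = j := by omega
    have hlast : 2 * (n + 1) + 1 - n = n / 2 + j + 3 := by omega
    have hfirst : 2 * 0 + 1 - (n + 2) = 0 := by omega
    rw [hdiv, hsub, hsub', hlast, hfirst]
    ring

theorem two_mul_sum_range_min (n k : ℕ) (h : n ≤ k) :
    (2 * (∑ e ∈ Finset.range (k + 1), min (e + 1) (2 * e + 1 - n) : ℕ) : ℤ) =
      (k + 1) * (k + 2) - 2 * bAuxInt (n - 1) := by
  induction k, h using Nat.le_induction with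
  | base =>
    have hmin : ∀ e ∈ Finset.range (n + 1), min (e + 1) (2 * e + 1 - n) = 2 * e + 1 - n :=
      fun e he => by have := Finset.mem_range.1 he; omega
    rw [Finset.sum_congr rfl hmin, sum_range_two_mul_add_one_sub, bAuxInt, sub_add_cancel]
    obtain ⟨m, rfl | rfl⟩ := Nat.even_or_odd' n
    · have hdiv : 2 * m / 2 = m := by omega
      have hsub : 2 * m - m = m := by omega
      have hdiv' : ((2 * m : ℕ) : ℤ) / 2 = m := by omega
      rw [hdiv, hsub, hdiv']
      push_cast
      ring
    · have hdiv : (2 * m + 1) / 2 = m := by omega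
      have hsub : 2 * m + 1 - m = m + 1 := by omega
      have hdiv' : ((2 * m + 1 : ℕ) : ℤ) / 2 = m := by omega
      rw [hdiv, hsub, hdiv']
      push_cast
      ring
  | succ k hk ih =>
    have hmin : min (k + 1 + 1) (2 * (k + 1) + 1 - n) = k + 2 := by omega
    rw [Finset.sum_range_succ, hmin]
    push_cast at ih ⊢
    linear_combination ih

/-- If `k₁ ≤ k₂ ≤ 2k₁`, then the `B₂` Kostant partition function equals
`(k₁+1)(k₁+2)/2 − b(2k₁ − k₂ − 1)`. -/
theorem kostant_partition_B2_case3 (k₁ k₂ : ℕ) (h1 : k₁ ≤ k₂) (h2 : k₂ ≤ 2 * k₁) :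
    (2 * kostantB2 k₁ k₂ : ℤ)
      = (k₁ + 1) * (k₁ + 2) - 2 * bAuxInt (2 * (k₁ : ℤ) - k₂ - 1) := by
  have hn : (2 * (k₁ : ℤ) - k₂ - 1) = ((2 * k₁ - k₂ : ℕ) : ℤ) - 1 := by omega
  rw [kostantB2_eq_sum k₁ k₂ h2, two_mul_sum_range_min _ _ (by omega), hn]
end

section
/- For every natural number p, the Kostka number K_{(12p, 8p, 3p)}(3p, 7p, 9p, 4p) — the number of semistandard Young tableaux of shape (12p, 8p, 3p) containing exactly 3p entries equal to 1, 7p entries equal to 2, 9p entries equal to 3, and 4p entries equal to 4 — equals (6 + 35p + 69p² + 46p³)/6. In particular, for p = 1 this number is 26: the multiplicity of the weight δ = {−4,−2,5} in the irreducible SU(4) representation of highest weight λ = {4,5,3}. -/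
/-- The row of length `n` whose entries `≤ 1`, `≤ 2`, `≤ 3`, `≤ 4` occupy the first `a`, `b`, `c`
and `n` boxes, respectively, extended by `0`. -/
def rowFill (a b c n j : ℕ) : ℕ :=
  if j < a then 1 else if j < b then 2 else if j < c then 3 else if j < n then 4 else 0

theorem exists_cut_of_monotone (f : ℕ → ℕ) (n k : ℕ) (hf : ∀ j, j + 1 < n → f j ≤ f (j + 1)) :
    ∃ m ≤ n, ∀ j < n, f j ≤ k ↔ j < m := by
  induction n with
  | zero => exact ⟨0, le_rfl, by simp⟩
  | succ n ih =>
    obtain ⟨m, hm, h⟩ := ih fun j hj => hf j (by omega)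
    by_cases hn : f n ≤ k
    · refine ⟨n + 1, le_rfl, fun j hj => ⟨fun _ => hj, fun _ => ?_⟩⟩
      rcases Nat.lt_succ_iff_lt_or_eq.1 hj with hj | rfl
      · rw [h j hj]
        by_contra hmj
        obtain ⟨l, rfl⟩ : ∃ l, n = l + 1 := ⟨n - 1, by omega⟩
        have := h l (by omega)
        have := hf l (by omega)
        omega
      · exact hn
    · refine ⟨m, by omega, fun j hj => ?_⟩
      rcases Nat.lt_succ_iff_lt_or_eq.1 hj with hj | rfl
      · exact h j hj
      · constructor <;> intro <;> omega

theorem exists_eq_rowFill (f : ℕ → ℕ) (n : ℕ) (hf : ∀ j, j + 1 < n → f j ≤ f (j + 1))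
    (hpos : ∀ j < n, 1 ≤ f j) (hle : ∀ j < n, f j ≤ 4) (hzero : ∀ j, n ≤ j → f j = 0) :
    ∃ a b c, a ≤ b ∧ b ≤ c ∧ c ≤ n ∧ f = rowFill a b c n := by
  obtain ⟨a, ha, hfa⟩ := exists_cut_of_monotone f n 1 hf
  obtain ⟨b, hb, hfb⟩ := exists_cut_of_monotone f n 2 hf
  obtain ⟨c, hc, hfc⟩ := exists_cut_of_monotone f n 3 hf
  have hab : a ≤ b := by
    by_contra h
    have := hfa b (by omega)
    have := hfb b (by omega)
    omega
  have hbc : b ≤ c := by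
    by_contra h
    have := hfb c (by omega)
    have := hfc c (by omega)
    omega
  refine ⟨a, b, c, hab, hbc, hc, funext fun j => ?_⟩
  unfold rowFill
  by_cases hj : j < n
  · have := hfa j hj
    have := hfb j hj
    have := hfc j hj
    have := hpos j hj
    have := hle j hj
    split_ifs <;> omega
  · have := hzero j (by omega)
    split_ifs <;> omega

/-- The number of boxes with entry `k` in the row `rowFill a b c n`. -/
def rowCount (a b c n : ℕ) : ℕ → ℕ
  | 1 => a
  | 2 => b - a
  | 3 => c - b
  | 4 => n - c
  | _ => 0

theorem ncard_rowFill_eq {a b c n : ℕ} (hab : a ≤ b) (hbc : b ≤ c) (hcn : c ≤ n) {k : ℕ}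
    (hk : 1 ≤ k) : {j | j < n ∧ rowFill a b c n j = k}.ncard = rowCount a b c n k := by
  have key : ∀ l u, (∀ j, (j < n ∧ rowFill a b c n j = k) ↔ l ≤ j ∧ j < u) →
      {j | j < n ∧ rowFill a b c n j = k}.ncard = u - l := by
    intro l u h
    have : {j | j < n ∧ rowFill a b c n j = k} = (Finset.Ico l u : Set ℕ) := by
      ext j
      simp [h]
    rw [this, Set.ncard_coe_finset, Nat.card_Ico]
  match k, hk with
  | 1, _ => exact key 0 a fun j => by unfold rowFill; split_ifs <;> omega
  | 2, _ => exact key a b fun j => by unfold rowFill; split_ifs <;> omega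
  | 3, _ => exact key b c fun j => by unfold rowFill; split_ifs <;> omega
  | 4, _ => exact key c n fun j => by unfold rowFill; split_ifs <;> omega
  | k + 5, _ =>
    rw [key 0 0 fun j => by unfold rowFill; split_ifs <;> omega]
    rfl

theorem rowFill_lt_rowFill_iff {a b c n a' b' c' m : ℕ} (hab : a ≤ b) (hbc : b ≤ c)
    (hab' : a' ≤ b') (hbc' : b' ≤ c') (hcm : c' ≤ m) (hmn : m ≤ n) :
    (∀ j < m, rowFill a b c n j < rowFill a' b' c' m j) ↔
      a' = 0 ∧ b' ≤ a ∧ c' ≤ b ∧ m ≤ c := by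
  constructor
  · intro h
    unfold rowFill at h
    refine ⟨?_, ?_, ?_, ?_⟩ <;> by_contra hlt
    · have := h 0 (by omega)
      split_ifs at this <;> omega
    · have := h a (by omega)
      split_ifs at this <;> omega
    · have := h b (by omega)
      split_ifs at this <;> omega
    · have := h c (by omega)
      split_ifs at this <;> omega
  · rintro ⟨h₁, h₂, h₃, h₄⟩ j hj
    unfold rowFill
    split_ifs <;> omega

theorem rowFill_mono {a b c n : ℕ} {j : ℕ} (hj : j + 1 < n) :
    rowFill a b c n j ≤ rowFill a b c n (j + 1) := by
  unfold rowFill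
  split_ifs <;> omega

theorem rowFill_pos {a b c n j : ℕ} (hj : j < n) : 1 ≤ rowFill a b c n j := by
  unfold rowFill
  split_ifs
  all_goals omega

theorem rowFill_eq_zero {a b c n j : ℕ} (hab : a ≤ b) (hbc : b ≤ c) (hcn : c ≤ n) (hj : n ≤ j) :
    rowFill a b c n j = 0 := by
  unfold rowFill
  split_ifs <;> omega

theorem rowFill_injective {a b c a' b' c' n : ℕ} (hab : a ≤ b) (hbc : b ≤ c) (hcn : c ≤ n)
    (hab' : a' ≤ b') (hbc' : b' ≤ c') (hcn' : c' ≤ n)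
    (h : rowFill a b c n = rowFill a' b' c' n) : a = a' ∧ b = b' ∧ c = c' := by
  have hcount : ∀ k, 1 ≤ k → rowCount a b c n k = rowCount a' b' c' n k := fun k hk => by
    rw [← ncard_rowFill_eq hab hbc hcn hk, ← ncard_rowFill_eq hab' hbc' hcn' hk, h]
  have h₁ := hcount 1 le_rfl
  have h₂ := hcount 2 (by omega)
  have h₃ := hcount 3 (by omega)
  simp only [rowCount] at h₁ h₂ h₃
  omega

/-- The boxes with entry `k` of a three-row filling are counted row by row. -/
theorem ncard_three_rows (r₀ r₁ r₂ k : ℕ) (T : ℕ × ℕ → ℕ) :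
    {c : ℕ × ℕ | c.2 < [r₀, r₁, r₂].getD c.1 0 ∧ T c = k}.ncard =
      {j | j < r₀ ∧ T (0, j) = k}.ncard + {j | j < r₁ ∧ T (1, j) = k}.ncard +
        {j | j < r₂ ∧ T (2, j) = k}.ncard := by
  classical
  have row : ∀ r i, {j | j < r ∧ T (i, j) = k}.ncard =
      (((Finset.range r).filter fun j => T (i, j) = k).image (Prod.mk i)).card := by
    intro r i
    rw [Finset.card_image_of_injective _ (Prod.mk_right_injective i), ← Set.ncard_coe_finset]
    congr 1
    ext j
    simp
  rw [row, row, row, ← Finset.card_union_of_disjoint, ← Finset.card_union_of_disjoint,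
    ← Set.ncard_coe_finset]
  · congr 1
    ext ⟨i, j⟩
    match i with
    | 0 => simp
    | 1 => simp
    | 2 => simp
    | i + 3 => simp
  · rw [Finset.disjoint_left]
    rintro ⟨i, j⟩ h h'
    simp only [Finset.mem_union, Finset.mem_image, Prod.mk.injEq] at h h'
    grind
  · rw [Finset.disjoint_left]
    rintro ⟨i, j⟩ h h'
    simp only [Finset.mem_image, Prod.mk.injEq] at h h'
    grind

/-- The tableau of shape `(12p, 8p, 3p)` and content `(3p, 7p, 9p, 4p)` with `c` entries `≤ 2` in
its second row, `e` entries `≤ 3` in its third row and `d` entries `≤ 3` in its second row. -/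
def su4Tableau (p c e d : ℕ) : ℕ × ℕ → ℕ
  | (0, j) => rowFill (3 * p) (10 * p - c) (19 * p - d - e) (12 * p) j
  | (1, j) => rowFill 0 c d (8 * p) j
  | (2, j) => rowFill 0 0 e (3 * p) j
  | (_ + 3, _) => 0

/-- The parameters `⟨c, e, d⟩` for which `su4Tableau p c e d` is semistandard. -/
def su4Params (p : ℕ) : Finset (Σ _ : ℕ, Σ _ : ℕ, ℕ) :=
  (Finset.range (3 * p + 1)).sigma fun c =>
    (Finset.range (c + 1)).sigma fun e => Finset.Icc (7 * p - e) (min (8 * p) (10 * p - c))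

theorem mem_su4Params {p c e d : ℕ} : ⟨c, e, d⟩ ∈ su4Params p ↔
    c ≤ 3 * p ∧ e ≤ c ∧ 7 * p ≤ d + e ∧ d ≤ 8 * p ∧ d + c ≤ 10 * p := by
  simp only [su4Params, Finset.mem_sigma, Finset.mem_range, Finset.mem_Icc]
  omega

/-- The defining property of the fillings counted by `kostka`. -/
def IsKostkaFilling (α ξ : ℕ → ℕ) (T : ℕ × ℕ → ℕ) : Prop :=
  (∀ i j, j + 1 < α i → T (i, j) ≤ T (i, j + 1)) ∧
  (∀ i j, j < α (i + 1) → T (i, j) < T (i + 1, j)) ∧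
  (∀ i j, j < α i → 1 ≤ T (i, j)) ∧
  (∀ i j, α i ≤ j → T (i, j) = 0) ∧
  (∀ k, 1 ≤ k → {c : ℕ × ℕ | c.2 < α c.1 ∧ T c = k}.ncard = ξ k)

theorem isKostkaFilling_su4Tableau {p c e d : ℕ} (h : ⟨c, e, d⟩ ∈ su4Params p) :
    IsKostkaFilling (fun i => [12 * p, 8 * p, 3 * p].getD i 0)
      (fun k => [0, 3 * p, 7 * p, 9 * p, 4 * p].getD k 0) (su4Tableau p c e d) := by
  rw [mem_su4Params] at h
  refine ⟨fun i j hj => ?_, fun i j hj => ?_, fun i j hj => ?_, fun i j hj => ?_, fun k hk => ?_⟩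
  · match i with
    | 0 => exact rowFill_mono hj
    | 1 => exact rowFill_mono hj
    | 2 => exact rowFill_mono hj
    | i + 3 => exact le_rfl
  · match i with
    | 0 =>
      exact (rowFill_lt_rowFill_iff (by omega) (by omega) (by omega) (by omega) (by omega)
        (by omega)).2 (by omega) j hj
    | 1 =>
      exact (rowFill_lt_rowFill_iff (by omega) (by omega) (by omega) (by omega) (by omega)
        (by omega)).2 (by omega) j hj
    | i + 2 => simp at hj
  · match i with
    | 0 => exact rowFill_pos hj
    | 1 => exact rowFill_pos hj
    | 2 => exact rowFill_pos hj
    | i + 3 => simp at hj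
  · match i with
    | 0 => exact rowFill_eq_zero (by omega) (by omega) (by omega) hj
    | 1 => exact rowFill_eq_zero (by omega) (by omega) (by omega) hj
    | 2 => exact rowFill_eq_zero (by omega) (by omega) (by omega) hj
    | i + 3 => rfl
  · rw [ncard_three_rows]
    simp only [su4Tableau]
    rw [ncard_rowFill_eq (by omega) (by omega) (by omega) hk,
      ncard_rowFill_eq (by omega) (by omega) (by omega) hk,
      ncard_rowFill_eq (by omega) (by omega) (by omega) hk]
    match k, hk with
    | 1, _ => simp [rowCount]
    | 2, _ => simp [rowCount]; omega
    | 3, _ => simp [rowCount]; omega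
    | 4, _ => simp [rowCount]; omega
    | k + 5, _ => simp [rowCount]

theorem exists_eq_su4Tableau {p : ℕ} {T : ℕ × ℕ → ℕ}
    (hT : IsKostkaFilling (fun i => [12 * p, 8 * p, 3 * p].getD i 0)
      (fun k => [0, 3 * p, 7 * p, 9 * p, 4 * p].getD k 0) T) :
    ∃ c e d, ⟨c, e, d⟩ ∈ su4Params p ∧ su4Tableau p c e d = T := by
  obtain ⟨hrow, hcol, hpos, hzero, hcount⟩ := hT
  have hrows : ∀ k, 1 ≤ k → {j | j < 12 * p ∧ T (0, j) = k}.ncard +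
      {j | j < 8 * p ∧ T (1, j) = k}.ncard + {j | j < 3 * p ∧ T (2, j) = k}.ncard =
        [0, 3 * p, 7 * p, 9 * p, 4 * p].getD k 0 := fun k hk => by
    rw [← ncard_three_rows, hcount k hk]
  have empty_of_ncard : ∀ r i k, {j | j < r ∧ T (i, j) = k}.ncard = 0 → ∀ j < r, T (i, j) ≠ k := by
    intro r i k h j hj hk
    rw [Set.ncard_eq_zero ((Set.finite_lt_nat r).subset fun j hj => hj.1)] at h
    exact (h ▸ ⟨hj, hk⟩ : j ∈ (∅ : Set ℕ))
  have hle : ∀ k, 5 ≤ k → (∀ j < 12 * p, T (0, j) ≠ k) ∧ (∀ j < 8 * p, T (1, j) ≠ k) ∧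
      ∀ j < 3 * p, T (2, j) ≠ k := by
    intro k hk
    have h := hrows k (by omega)
    rw [List.getD_eq_default _ _ (by simpa using hk)] at h
    exact ⟨empty_of_ncard _ _ _ (by omega), empty_of_ncard _ _ _ (by omega),
      empty_of_ncard _ _ _ (by omega)⟩
  obtain ⟨a₀, b₀, c₀, hab₀, hbc₀, hc₀, h₀⟩ := exists_eq_rowFill (fun j => T (0, j)) (12 * p)
    (hrow 0) (hpos 0) (fun j hj => by
      by_contra h
      exact (hle _ (by omega)).1 j hj rfl) (hzero 0)
  obtain ⟨a₁, b₁, c₁, hab₁, hbc₁, hc₁, h₁⟩ := exists_eq_rowFill (fun j => T (1, j)) (8 * p)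
    (hrow 1) (hpos 1) (fun j hj => by
      by_contra h
      exact (hle _ (by omega)).2.1 j hj rfl) (hzero 1)
  obtain ⟨a₂, b₂, c₂, hab₂, hbc₂, hc₂, h₂⟩ := exists_eq_rowFill (fun j => T (2, j)) (3 * p)
    (hrow 2) (hpos 2) (fun j hj => by
      by_contra h
      exact (hle _ (by omega)).2.2 j hj rfl) (hzero 2)
  replace h₀ : ∀ j, T (0, j) = _ := congrFun h₀
  replace h₁ : ∀ j, T (1, j) = _ := congrFun h₁
  replace h₂ : ∀ j, T (2, j) = _ := congrFun h₂
  have hcol₀ := (rowFill_lt_rowFill_iff hab₀ hbc₀ hab₁ hbc₁ hc₁ (n := 12 * p) (by omega)).1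
    fun j hj => by rw [← h₀, ← h₁]; exact hcol 0 j hj
  have hcol₁ := (rowFill_lt_rowFill_iff hab₁ hbc₁ hab₂ hbc₂ hc₂ (n := 8 * p) (by omega)).1
    fun j hj => by rw [← h₁, ← h₂]; exact hcol 1 j hj
  have hcounts : ∀ k, 1 ≤ k → rowCount a₀ b₀ c₀ (12 * p) k + rowCount a₁ b₁ c₁ (8 * p) k +
      rowCount a₂ b₂ c₂ (3 * p) k = [0, 3 * p, 7 * p, 9 * p, 4 * p].getD k 0 := fun k hk => by
    rw [← hrows k hk]
    simp only [h₀, h₁, h₂]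
    rw [ncard_rowFill_eq hab₀ hbc₀ hc₀ hk, ncard_rowFill_eq hab₁ hbc₁ hc₁ hk,
      ncard_rowFill_eq hab₂ hbc₂ hc₂ hk]
  have k₁ : a₀ + a₁ + a₂ = 3 * p := hcounts 1 le_rfl
  have k₂ : b₀ - a₀ + (b₁ - a₁) + (b₂ - a₂) = 7 * p := hcounts 2 (by omega)
  have k₃ : c₀ - b₀ + (c₁ - b₁) + (c₂ - b₂) = 9 * p := hcounts 3 (by omega)
  refine ⟨b₁, c₂, c₁, mem_su4Params.2 (by omega), funext fun ⟨i, j⟩ => ?_⟩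
  match i with
  | 0 =>
    rw [h₀, su4Tableau]
    congr 1 <;> omega
  | 1 =>
    rw [h₁, su4Tableau]
    congr 1
    omega
  | 2 =>
    rw [h₂, su4Tableau]
    congr 1 <;> omega
  | i + 3 => exact (hzero (i + 3) j (by simp)).symm

theorem kostka_eq_card_su4Params (p : ℕ) :
    kostka (fun i => [12 * p, 8 * p, 3 * p].getD i 0)
      (fun k => [0, 3 * p, 7 * p, 9 * p, 4 * p].getD k 0) = (su4Params p).card := by
  let F : su4Params p → {T // IsKostkaFilling (fun i => [12 * p, 8 * p, 3 * p].getD i 0)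
      (fun k => [0, 3 * p, 7 * p, 9 * p, 4 * p].getD k 0) T} :=
    fun x => ⟨su4Tableau p x.1.1 x.1.2.1 x.1.2.2, isKostkaFilling_su4Tableau x.2⟩
  have hF : Function.Bijective F := by
    constructor
    · rintro ⟨⟨c, e, d⟩, h⟩ ⟨⟨c', e', d'⟩, h'⟩ heq
      have hT : su4Tableau p c e d = su4Tableau p c' e' d' := congrArg Subtype.val heq
      rw [mem_su4Params] at h h'
      obtain ⟨-, rfl, rfl⟩ := rowFill_injective (by omega) (by omega) (by omega) (by omega)
        (by omega) (by omega) (funext fun j => congrFun hT (1, j))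
      obtain ⟨-, -, rfl⟩ := rowFill_injective (by omega) (by omega) (by omega) (by omega)
        (by omega) (by omega) (funext fun j => congrFun hT (2, j))
      rfl
    · rintro ⟨T, hT⟩
      obtain ⟨c, e, d, h, rfl⟩ := exists_eq_su4Tableau hT
      exact ⟨⟨⟨c, e, d⟩, h⟩, rfl⟩
  rw [← Nat.card_eq_finsetCard]
  exact (Nat.card_congr (Equiv.ofBijective F hF)).symm

theorem two_mul_sum_range_add (q : ℤ) (m : ℕ) :
    2 * ∑ e ∈ Finset.range m, (q + e) = m * (2 * q + m - 1) := by
  induction m with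
  | zero => simp
  | succ m ih =>
    rw [Finset.sum_range_succ, mul_add, ih]
    push_cast
    ring

theorem six_mul_card_su4Params (p : ℕ) :
    6 * (su4Params p).card = 6 + 35 * p + 69 * p ^ 2 + 46 * p ^ 3 := by
  have inner_low : ∀ c ∈ Finset.range (2 * p + 1),
      2 * ∑ e ∈ Finset.range (c + 1), ((min (8 * p) (10 * p - c) + 1 - (7 * p - e) : ℕ) : ℤ) =
        (c + 1) * (2 * p + 2 + c) := by
    intro c hc
    rw [Finset.mem_range] at hc
    rw [Finset.sum_congr rfl fun (e : ℕ) he => show _ = ((p + 1 : ℤ) + (e : ℤ)) by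
      rw [Finset.mem_range] at he
      omega, two_mul_sum_range_add]
    push_cast
    ring
  have inner_high : ∀ t ∈ Finset.range p,
      2 * ∑ e ∈ Finset.range (2 * p + 1 + t + 1),
        ((min (8 * p) (10 * p - (2 * p + 1 + t)) + 1 - (7 * p - e) : ℕ) : ℤ) =
          (2 * p + 2 + t) * (4 * p + 1 - t) := by
    intro t ht
    rw [Finset.mem_range] at ht
    rw [Finset.sum_congr rfl fun (e : ℕ) he => show _ = ((p - t : ℤ) + (e : ℤ)) by
      rw [Finset.mem_range] at he
      omega, two_mul_sum_range_add]
    push_cast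
    ring
  have sum_low : ∀ m : ℕ, 6 * ∑ c ∈ Finset.range m, ((c : ℤ) + 1) * (2 * p + 2 + c) =
      m * (m + 1) * (6 * p + 2 * m + 4) := by
    intro m
    induction m with
    | zero => simp
    | succ m ih =>
      rw [Finset.sum_range_succ, mul_add, ih]
      push_cast
      ring
  have sum_high : ∀ m : ℕ, 6 * ∑ t ∈ Finset.range m, (2 * p + 2 + t : ℤ) * (4 * p + 1 - t) =
      6 * m * (2 * p + 2) * (4 * p + 1) + 3 * (2 * p - 1) * m * (m - 1)
        - m * (m - 1) * (2 * m - 1) := by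
    intro m
    induction m with
    | zero => simp
    | succ m ih =>
      rw [Finset.sum_range_succ, mul_add, ih]
      push_cast
      ring
  have hlow := sum_low (2 * p + 1)
  have hhigh := sum_high p
  rw [← Finset.sum_congr rfl inner_low, ← Finset.mul_sum] at hlow
  rw [← Finset.sum_congr rfl inner_high, ← Finset.mul_sum] at hhigh
  zify
  simp only [su4Params, Finset.card_sigma, Nat.card_Icc]
  rw [show 3 * p + 1 = 2 * p + 1 + p by ring, Finset.sum_range_add]
  simp only [Nat.cast_add, Nat.cast_mul, Nat.cast_sum, Nat.cast_one, Nat.cast_ofNat] at hlow hhigh ⊢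
  linarith

/-- The stretched Kostka number `K_{(12p, 8p, 3p)}(3p, 7p, 9p, 4p)` — the multiplicity of
the weight `δ = {−4,−2,5}` in the irreducible `SU(4)` representation of highest weight
`λ = {4,5,3}`, with both weights stretched by `p` — equals
`(6 + 35p + 69p² + 46p³)/6`; in particular it equals `26` for `p = 1`. -/
theorem kostka_su4_stretched_polynomial (p : ℕ) :
    6 * kostka (fun i => [12 * p, 8 * p, 3 * p].getD i 0)
        (fun k => [0, 3 * p, 7 * p, 9 * p, 4 * p].getD k 0)
      = 6 + 35 * p + 69 * p ^ 2 + 46 * p ^ 3 := by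
  rw [kostka_eq_card_su4Params, six_mul_card_su4Params]
end

section
/- Let α_1 ≥ α_2 ≥ α_3 ≥ α_4 be real numbers. Then the convex hull in ℝ⁴ of the 24 vectors (α_{σ(1)}, α_{σ(2)}, α_{σ(3)}, α_{σ(4)}) over all permutations σ of {1,2,3,4} equals the set of points ξ ∈ ℝ⁴ satisfying ξ_1 + ξ_2 + ξ_3 + ξ_4 = α_1 + α_2 + α_3 + α_4, α_4 ≤ ξ_i ≤ α_1 for all 1 ≤ i ≤ 4, and α_3 + α_4 ≤ ξ_i + ξ_j ≤ α_1 + α_2 for all 1 ≤ i < j ≤ 4. -/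
/-- The points of `ℝ⁴` cut out by the inequalities of the permutahedron form a convex set. -/
theorem convex_permutahedron_inequalities (α : Fin 4 → ℝ) :
    Convex ℝ {ξ : Fin 4 → ℝ |
      (∑ i, ξ i = ∑ i, α i) ∧
      (∀ i, α 3 ≤ ξ i ∧ ξ i ≤ α 0) ∧
      (∀ i j, i < j → α 2 + α 3 ≤ ξ i + ξ j ∧ ξ i + ξ j ≤ α 0 + α 1)} := by
  have between {l u x y a b : ℝ} (hx : l ≤ x ∧ x ≤ u) (hy : l ≤ y ∧ y ≤ u)
      (ha : 0 ≤ a) (hb : 0 ≤ b) (hab : a + b = 1) : l ≤ a * x + b * y ∧ a * x + b * y ≤ u :=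
    convex_Icc l u hx hy ha hb hab
  rintro x ⟨hxs, hx, hx'⟩ y ⟨hys, hy, hy'⟩ a b ha hb hab
  refine ⟨?_, fun i => between (hx i) (hy i) ha hb hab, fun i j hij => ?_⟩
  · simp only [Pi.add_apply, Pi.smul_apply, smul_eq_mul, Finset.sum_add_distrib,
      ← Finset.mul_sum, hxs, hys, ← add_mul, hab, one_mul]
  · have h := between (hx' i j hij) (hy' i j hij) ha hb hab
    simp only [Pi.add_apply, Pi.smul_apply, smul_eq_mul]
    constructor <;> linarith

/-- A linear functional takes at a point satisfying the inequalities of the permutahedron a value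
at most the one it takes at some permutation of `α`. -/
theorem exists_perm_sum_mul_le (α ξ c : Fin 4 → ℝ)
    (hsum : ∑ i, ξ i = ∑ i, α i) (hξ : ∀ i, α 3 ≤ ξ i ∧ ξ i ≤ α 0)
    (hpair : ∀ i j, i < j → ξ i + ξ j ≤ α 0 + α 1) :
    ∃ σ : Equiv.Perm (Fin 4), ∑ i, c i * ξ i ≤ ∑ i, c i * α (σ i) := by
  have hmono := Tuple.monotone_sort (-c)
  set τ := Tuple.sort (-c)
  refine ⟨τ.symm, ?_⟩
  rw [← Equiv.sum_comp τ (fun i => c i * ξ i), ← Equiv.sum_comp τ (fun i => c i * α (τ.symm i))]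
  rw [← Equiv.sum_comp τ ξ] at hsum
  have hpair' : ξ (τ 0) + ξ (τ 1) ≤ α 0 + α 1 := by
    rcases lt_or_gt_of_ne (τ.injective.ne (show (0 : Fin 4) ≠ 1 by decide)) with h | h
    · exact hpair _ _ h
    · linarith [hpair _ _ h]
  have h01 : c (τ 1) ≤ c (τ 0) := neg_le_neg_iff.1 (hmono (show (0 : Fin 4) ≤ 1 by decide))
  have h12 : c (τ 2) ≤ c (τ 1) := neg_le_neg_iff.1 (hmono (show (1 : Fin 4) ≤ 2 by decide))
  have h23 : c (τ 3) ≤ c (τ 2) := neg_le_neg_iff.1 (hmono (show (2 : Fin 4) ≤ 3 by decide))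
  simp only [Fin.sum_univ_four, Equiv.symm_apply_apply] at hsum ⊢
  have hlast : ξ (τ 3) = α 0 + α 1 + α 2 + α 3 - ξ (τ 0) - ξ (τ 1) - ξ (τ 2) := by linarith
  have htriple : ξ (τ 0) + ξ (τ 1) + ξ (τ 2) ≤ α 0 + α 1 + α 2 := by linarith [(hξ (τ 3)).1]
  rw [hlast]
  -- Abel summation against the decreasing coefficients
  linarith [mul_le_mul_of_nonneg_left (hξ (τ 0)).2 (sub_nonneg.2 h01),
    mul_le_mul_of_nonneg_left hpair' (sub_nonneg.2 h12),
    mul_le_mul_of_nonneg_left htriple (sub_nonneg.2 h23)]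

/-- For `α₁ ≥ α₂ ≥ α₃ ≥ α₄`, the permutahedron (the convex hull in `ℝ⁴` of the 24
permutations of `(α₁, α₂, α₃, α₄)`) is exactly the set of points `ξ` with
`∑ ξᵢ = ∑ αᵢ`, `α₄ ≤ ξᵢ ≤ α₁` for all `i`, and `α₃ + α₄ ≤ ξᵢ + ξⱼ ≤ α₁ + α₂`
for all `i < j`. -/
theorem permutahedron_eq_inequalities
    (α : Fin 4 → ℝ) (h12 : α 1 ≤ α 0) (h23 : α 2 ≤ α 1) (h34 : α 3 ≤ α 2) :
    convexHull ℝ {v : Fin 4 → ℝ | ∃ σ : Equiv.Perm (Fin 4), v = α ∘ σ}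
      = {ξ : Fin 4 → ℝ |
          (∑ i, ξ i = ∑ i, α i) ∧
          (∀ i, α 3 ≤ ξ i ∧ ξ i ≤ α 0) ∧
          (∀ i j, i < j → α 2 + α 3 ≤ ξ i + ξ j ∧ ξ i + ξ j ≤ α 0 + α 1)} := by
  apply Set.Subset.antisymm
  · refine convexHull_min ?_ (convex_permutahedron_inequalities α)
    rintro _ ⟨σ, rfl⟩
    refine ⟨Equiv.sum_comp σ α, fun i => ?_, fun i j hij => ?_⟩
    · simp only [Function.comp_apply]
      generalize σ i = k
      fin_cases k <;> constructor <;> simp <;> linarith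
    · have hne := σ.injective.ne hij.ne
      simp only [Function.comp_apply]
      generalize σ i = k at hne ⊢
      generalize σ j = l at hne ⊢
      fin_cases k <;> fin_cases l <;>
        first
        | exact absurd rfl hne
        | (constructor <;> dsimp <;> linarith)
  · rintro ξ ⟨hsum, hξ, hpair⟩
    by_contra hnot
    have hfin : {v : Fin 4 → ℝ | ∃ σ : Equiv.Perm (Fin 4), v = α ∘ σ}.Finite :=
      (Set.finite_range fun σ : Equiv.Perm (Fin 4) => α ∘ σ).subset
        fun _ ⟨σ, hσ⟩ => ⟨σ, hσ.symm⟩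
    obtain ⟨f, u, hf, hu⟩ := geometric_hahn_banach_closed_point (convex_convexHull ℝ _)
      (hfin.isClosed_convexHull ℝ) hnot
    have hf_eq (x : Fin 4 → ℝ) : f x = ∑ i, f (Pi.single i 1) * x i := by
      conv_lhs => rw [pi_eq_sum_univ' x]
      simp [mul_comm]
    obtain ⟨σ, hσ⟩ := exists_perm_sum_mul_le α ξ (fun i => f (Pi.single i 1)) hsum hξ
      fun i j hij => (hpair i j hij).2
    have hlt := hf (α ∘ σ) (subset_convexHull ℝ _ ⟨σ, rfl⟩)
    rw [hf_eq] at hlt hu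
    exact absurd (hu.trans_le hσ) hlt.not_gt
end
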